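/- arXiv:1008.1931 — 9 statements merged into one kernel-verified Lean document; each statement's English description precedes it below -/
import Mathlib

section
/- Let p ∈ ℝ[x₁,…,xₙ] be a real zero polynomial of degree d. If p has a hermitian determinantal representation (of any size k), then p has a hermitian determinantal representation of size n·d. -/
open MvPolynomial Matrix

/-- The monic hermitian linear matrix polynomial `I + x₁M₁ + ⋯ + xₙMₙ`. -/
noncomputable def pencil {n k : ℕ} (M : Fin n → Matrix (Fin k) (Fin k) ℂ) :
    Matrix (Fin k) (Fin k) (MvPolynomial (Fin n) ℂ) :=
  1 + ∑ i, (M i).map (fun c => MvPolynomial.C c * MvPolynomial.X i)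

/-- `p` is a real zero polynomial. -/
def IsRZ {n : ℕ} (p : MvPolynomial (Fin n) ℝ) : Prop :=
  MvPolynomial.eval (0 : Fin n → ℝ) p = 1 ∧
  ∀ (a : Fin n → ℝ) (μ : ℂ),
    MvPolynomial.eval (fun i => μ * (a i : ℂ)) (MvPolynomial.map (algebraMap ℝ ℂ) p) = 0 →
    μ.im = 0

/-- `p` has a hermitian determinantal representation of size `k`. -/
def HasHermRep {n : ℕ} (p : MvPolynomial (Fin n) ℝ) (k : ℕ) : Prop :=
  ∃ M : Fin n → Matrix (Fin k) (Fin k) ℂ, (∀ i, (M i).IsHermitian) ∧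
    MvPolynomial.map (algebraMap ℝ ℂ) p = (pencil M).det

theorem Submodule.finrank_finset_sup_le_sum {K V ι : Type*} [DivisionRing K] [AddCommGroup V]
    [Module K V] [FiniteDimensional K V] (s : Finset ι) (W : ι → Submodule K V) :
    Module.finrank K (s.sup W : Submodule K V) ≤ ∑ i ∈ s, Module.finrank K (W i) := by
  classical
  induction s using Finset.induction_on with
  | empty => simp
  | insert a s ha ih =>
    rw [Finset.sup_insert, Finset.sum_insert ha]
    exact (Submodule.finrank_add_le_finrank_add_finrank _ _).trans (by gcongr)

/-- The reversed characteristic polynomial of a hermitian matrix has degree equal to the rank. -/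
theorem Matrix.IsHermitian.natDegree_charpolyRev {m : Type*} [Fintype m] [DecidableEq m]
    {A : Matrix m m ℂ} (hA : A.IsHermitian) : A.charpolyRev.natDegree = A.rank := by
  classical
  rw [← reverse_charpoly, Polynomial.reverse_natDegree, charpoly_natDegree_eq_dim,
    ← Polynomial.rootMultiplicity_eq_natTrailingDegree', ← Polynomial.count_roots,
    hA.roots_charpoly_eq_eigenvalues, Multiset.count_map, hA.rank_eq_card_non_zero_eigs,
    Fintype.card_subtype_compl, Fintype.card_subtype]
  congr 1
  simp only [Finset.card, Finset.filter, Function.comp_apply, eq_comm (a := (0 : ℂ)),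
    RCLike.ofReal_eq_zero]

/-- The restriction of the pencil to a coordinate axis is a reversed characteristic polynomial. -/
theorem aeval_det_pencil {n k : ℕ} (M : Fin n → Matrix (Fin k) (Fin k) ℂ) (i : Fin n) :
    aeval (Pi.single i (-Polynomial.X) : Fin n → Polynomial ℂ) (pencil M).det =
      (M i).charpolyRev := by
  rw [AlgHom.map_det, charpolyRev]
  congr 1
  ext1 a b
  simp only [pencil, AlgHom.mapMatrix_apply, Matrix.map_apply, Matrix.add_apply, Matrix.sum_apply,
    map_add, map_sum, map_mul, aeval_X, algHom_C, Matrix.sub_apply, Matrix.smul_apply, smul_eq_mul]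
  rw [Finset.sum_eq_single i (fun j _ hj => by simp [hj]) (by simp)]
  by_cases hab : a = b <;> simp [Matrix.one_apply, hab] <;> ring

theorem rank_le_totalDegree {n k : ℕ} {M : Fin n → Matrix (Fin k) (Fin k) ℂ} {i : Fin n}
    (hM : (M i).IsHermitian) : (M i).rank ≤ (pencil M).det.totalDegree := by
  rw [← hM.natDegree_charpolyRev, ← aeval_det_pencil]
  refine (aeval_natDegree_le _ le_rfl _ (n := 1) fun j => ?_).trans_eq (mul_one _)
  rcases eq_or_ne j i with rfl | h <;> simp [*]

/-- A factored orthogonal projection onto the span of the ranges of the given matrices. -/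
theorem exists_mul_conjTranspose_mul_eq {n k d : ℕ} {M : Fin n → Matrix (Fin k) (Fin k) ℂ}
    (hM : ∀ i, (M i).rank ≤ d) :
    ∃ B : Matrix (Fin k) (Fin (n * d)) ℂ, ∀ i, B * Bᴴ * M i = M i := by
  classical
  let V : Submodule ℂ (EuclideanSpace ℂ (Fin k)) :=
    Finset.univ.sup fun i => LinearMap.range (toLpLin 2 2 (M i))
  have hV : Module.finrank ℂ V ≤ n * d := by
    refine (Submodule.finrank_finset_sup_le_sum _ _).trans ?_
    refine (Finset.sum_le_card_nsmul _ _ d fun i _ => ?_).trans_eq (by simp)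
    rw [toLpLin_eq_toLin, ← rank_eq_finrank_range_toLin]
    exact hM i
  let b := stdOrthonormalBasis ℂ V
  let B : Matrix (Fin k) (Fin (Module.finrank ℂ V)) ℂ := of fun a j => (b j).1 a
  let Z : Matrix (Fin (Module.finrank ℂ V)) (Fin (n * d)) ℂ :=
    (1 : Matrix (Fin (n * d)) (Fin (n * d)) ℂ).submatrix (Fin.castLE hV) id
  have hZ : Z * Zᴴ = 1 := by
    simp only [Z, conjTranspose_submatrix, conjTranspose_one]
    rw [← submatrix_mul _ _ _ _ _ Function.bijective_id, mul_one,
      submatrix_one _ (Fin.castLE_injective hV)]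
  refine ⟨B * Z, fun i => ?_⟩
  have hB : B * Z * (B * Z)ᴴ = B * Bᴴ := by
    rw [conjTranspose_mul, Matrix.mul_assoc, ← Matrix.mul_assoc Z, hZ, Matrix.one_mul]
  rw [hB]
  ext a c
  have hmem : (WithLp.toLp 2 ((M i).col c) : EuclideanSpace ℂ (Fin k)) ∈ V := by
    refine (Finset.le_sup (f := fun i => LinearMap.range (toLpLin 2 2 (M i)))
      (Finset.mem_univ i)) ⟨EuclideanSpace.single c 1, ?_⟩
    ext
    simp [toLpLin_apply]
  have h := congrArg (fun v : V => v.1 a) (b.sum_repr' ⟨_, hmem⟩)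
  rw [Matrix.mul_assoc, Matrix.mul_apply]
  simpa [B, Matrix.mul_apply, PiLp.inner_apply, Matrix.col, mul_comm] using h

theorem pencil_eq_one_add {n k : ℕ} (M : Fin n → Matrix (Fin k) (Fin k) ℂ) :
    pencil M = 1 + ∑ i, (X i : MvPolynomial (Fin n) ℂ) • (M i).map C := by
  unfold pencil
  congr! 2 with i
  ext1 a b
  simp [mul_comm]

/-- Compressing to the joint range of the matrices preserves the determinant of the pencil. -/
theorem det_pencil_compress {n k m : ℕ} {M : Fin n → Matrix (Fin k) (Fin k) ℂ}
    {B : Matrix (Fin k) (Fin m) ℂ} (hB : ∀ i, B * Bᴴ * M i = M i) :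
    (pencil fun i => Bᴴ * M i * B).det = (pencil M).det := by
  have h (i : Fin n) : (M i).map (C (σ := Fin n)) =
      (B.map C : Matrix (Fin k) (Fin m) (MvPolynomial (Fin n) ℂ)) *
        ((Bᴴ * M i).map C : Matrix (Fin m) (Fin k) (MvPolynomial (Fin n) ℂ)) := by
    rw [← Matrix.map_mul, ← Matrix.mul_assoc, hB]
  have h' (i : Fin n) : (Bᴴ * M i * B).map (C (σ := Fin n)) =
      ((Bᴴ * M i).map C : Matrix (Fin m) (Fin k) (MvPolynomial (Fin n) ℂ)) *
        (B.map C : Matrix (Fin k) (Fin m) (MvPolynomial (Fin n) ℂ)) := Matrix.map_mul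
  simp_rw [pencil_eq_one_add, h, h', ← Matrix.mul_smul, ← Matrix.mul_sum, Matrix.mul_smul,
    ← Matrix.smul_mul, ← Matrix.sum_mul]
  rw [det_one_add_mul_comm]

/-- If a real zero polynomial of degree `d` in `n` variables has a hermitian determinantal
representation of some size, then it has one of size `n·d`. -/
theorem hermRep_of_size_nd {n : ℕ} (p : MvPolynomial (Fin n) ℝ) (hrz : IsRZ p)
    (d : ℕ) (hd : p.totalDegree = d) (k : ℕ) (h : HasHermRep p k) :
    HasHermRep p (n * d) := by
  obtain ⟨M, hM, hp⟩ := h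
  have hr (i : Fin n) : (M i).rank ≤ d := by
    refine (rank_le_totalDegree (hM i)).trans ?_
    rw [← hp, ← hd]
    exact Finset.sup_mono (support_map_subset _ _)
  obtain ⟨B, hB⟩ := exists_mul_conjTranspose_mul_eq hr
  exact ⟨fun i => Bᴴ * M i * B, fun i => isHermitian_conjTranspose_mul_mul B (hM i),
    hp.trans (det_pencil_compress hB).symm⟩
end

section
/- Let V be an ℝ-linear subspace of the complex hermitian k×k matrices such that every element of V has rank at most d. If V contains a positive semidefinite matrix of rank exactly d, then there exists a unitary k×k matrix Q such that for every M ∈ V, the matrix Q*MQ has (i,j)-entry equal to 0 whenever i > d or j > d (i.e., Q*VQ is contained in the matrices supported on the upper-left d×d block). If moreover V consists of real symmetric matrices, then Q can be chosen real orthogonal. -/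
open Matrix
open scoped ComplexOrder

open Filter Topology

namespace Matrix

theorem rank_map_algebraMap {n K L : Type*} [Fintype n] [DecidableEq n] [Field K] [Field L]
    [Algebra K L] (A : Matrix n n K) : (A.map (algebraMap K L)).rank = A.rank := by
  classical
  obtain ⟨S, T, D, h⟩ := Pivot.exists_list_transvec_mul_mul_list_transvec_eq_diagonal A
  set X := (S.map TransvectionStruct.toMatrix).prod
  set Y := (T.map TransvectionStruct.toMatrix).prod
  have hX : X.det = 1 := TransvectionStruct.det_toMatrix_prod S
  have hY : Y.det = 1 := TransvectionStruct.det_toMatrix_prod T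
  have hX' : (X.map (algebraMap K L)).det = 1 := by
    rw [← RingHom.mapMatrix_apply, ← RingHom.map_det, hX, map_one]
  have hY' : (Y.map (algebraMap K L)).det = 1 := by
    rw [← RingHom.mapMatrix_apply, ← RingHom.map_det, hY, map_one]
  have h' := congrArg (fun B => B.map (algebraMap K L)) h
  simp only [Matrix.map_mul, diagonal_map (map_zero (algebraMap K L))] at h'
  rw [← rank_mul_eq_right_of_isUnit_det _ A (by rw [hX]; exact isUnit_one),
    ← rank_mul_eq_left_of_isUnit_det Y (X * A) (by rw [hY]; exact isUnit_one), h,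
    ← rank_mul_eq_right_of_isUnit_det _ (A.map (algebraMap K L)) (by rw [hX']; exact isUnit_one),
    ← rank_mul_eq_left_of_isUnit_det (Y.map (algebraMap K L)) _ (by rw [hY']; exact isUnit_one),
    h', rank_diagonal, rank_diagonal]
  simp

theorem det_eq_zero_of_rank_lt {n K : Type*} [Fintype n] [DecidableEq n] [Field K]
    {A : Matrix n n K} (h : A.rank < Fintype.card n) : A.det = 0 := by
  by_contra hA
  have hu : IsUnit A := (isUnit_iff_isUnit_det A).2 (isUnit_iff_ne_zero.2 hA)
  exact h.ne (rank_of_isUnit A hu)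

/-- If a pencil of matrices bordered by one row and one column, with invertible corner at `0`, is
singular everywhere, then the corner of the border vanishes and so does the Schur complement. -/
theorem border_eq_zero_of_det_pencil {m 𝕜 : Type*} [Fintype m] [DecidableEq m] [RCLike 𝕜]
    {D A : Matrix m m 𝕜} {B : Matrix m Unit 𝕜} {C : Matrix Unit m 𝕜} {E : Matrix Unit Unit 𝕜}
    (hD : D.det ≠ 0)
    (h : ∀ s : ℝ, (fromBlocks (D + s • A) (s • B) (s • C) (s • E)).det = 0) :
    E = 0 ∧ C * D⁻¹ * B = 0 := by
  have hlin : Continuous fun s : ℝ => D + s • A := by fun_prop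
  have hinv : ContinuousAt (fun s : ℝ => (D + s • A)⁻¹) 0 := by
    refine ContinuousAt.comp (g := Inv.inv) (continuousAt_matrix_inv _ ?_) hlin.continuousAt
    rw [Ring.inverse_eq_inv']
    exact continuousAt_inv₀ (by simpa using hD)
  have hg : Tendsto (fun s : ℝ => C * (D + s • A)⁻¹ * B) (𝓝[≠] 0) (𝓝 (C * D⁻¹ * B)) := by
    have hc : ContinuousAt (fun s : ℝ => C * (D + s • A)⁻¹ * B) 0 := by
      have hmul : Continuous fun X : Matrix m m 𝕜 => C * X * B := by fun_prop
      exact hmul.continuousAt.comp hinv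
    simpa using hc.tendsto.mono_left nhdsWithin_le_nhds
  have hdet : ∀ᶠ s : ℝ in 𝓝[≠] 0, (D + s • A).det ≠ 0 :=
    (hlin.matrix_det.continuousAt.eventually_ne (by simpa using hD)).filter_mono
      nhdsWithin_le_nhds
  have hE : ∀ᶠ s : ℝ in 𝓝[≠] 0, E = s • (C * (D + s • A)⁻¹ * B) := by
    filter_upwards [hdet, self_mem_nhdsWithin] with s hs hs0
    have hs0 : s ≠ 0 := hs0
    have hu : IsUnit (D + s • A).det := isUnit_iff_ne_zero.2 hs
    let := invertibleOfIsUnitDet _ hu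
    have h1 := h s
    rw [det_fromBlocks₁₁, mul_eq_zero, or_iff_right hs, invOf_eq_nonsing_inv, det_unique] at h1
    have h2 : s • E = s • (s • (C * (D + s • A)⁻¹ * B)) := by
      ext i j
      simpa [sub_eq_zero] using h1
    exact smul_right_injective _ hs0 h2
  have hE0 : E = 0 := by
    have hs : Tendsto (fun s : ℝ => s) (𝓝[≠] 0) (𝓝 0) :=
      tendsto_id.mono_left nhdsWithin_le_nhds
    have ht := hs.smul hg
    rw [zero_smul] at ht
    exact tendsto_nhds_unique (tendsto_const_nhds.congr' hE) ht
  refine ⟨hE0, tendsto_nhds_unique hg ?_⟩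
  refine tendsto_const_nhds.congr' ?_
  filter_upwards [hE, self_mem_nhdsWithin] with s hs hs0
  rw [hE0] at hs
  exact ((smul_eq_zero.1 hs.symm).resolve_left hs0).symm

/-- If no element of the line `P + ℝ M` has rank larger than that of the positive semidefinite
matrix `P`, then in an eigenbasis of `P` the columns of `M` indexed by `ker P` vanish. -/
theorem PosSemidef.conj_eigenvectorUnitary_apply_eq_zero {n 𝕜 : Type*} [Fintype n] [DecidableEq n]
    [RCLike 𝕜] {P M : Matrix n n 𝕜} (hP : P.PosSemidef) (hM : M.IsHermitian)
    (hrank : ∀ s : ℝ, (P + s • M).rank ≤ P.rank) {i j : n} (hj : hP.1.eigenvalues j = 0) :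
    ((hP.1.eigenvectorUnitary : Matrix n n 𝕜)ᴴ * M * hP.1.eigenvectorUnitary) i j = 0 := by
  set U : Matrix n n 𝕜 := ↑hP.1.eigenvectorUnitary
  set ev := hP.1.eigenvalues
  set N := Uᴴ * M * U with hN
  have hNherm : N.IsHermitian := isHermitian_conjTranspose_mul_mul U hM
  have hdiag : Uᴴ * P * U = diagonal fun i => (ev i : 𝕜) := by
    have := hP.1.conjStarAlgAut_star_eigenvectorUnitary
    rw [Unitary.conjStarAlgAut_apply] at this
    simpa [star_eq_conjTranspose] using! this
  have hT : ∀ s : ℝ, ((diagonal fun i => (ev i : 𝕜)) + s • N).rank ≤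
      Fintype.card {i // ev i ≠ 0} := fun s => by
    have h1 : (diagonal fun i => (ev i : 𝕜)) + s • N = Uᴴ * (P + s • M) * U := by
      rw [← hdiag, hN, mul_add, add_mul, Matrix.mul_smul, Matrix.smul_mul]
    rw [h1, ← hP.1.rank_eq_card_non_zero_eigs]
    exact (rank_mul_le_left _ _).trans ((rank_mul_le_right _ _).trans (hrank s))
  let ι := {i // ev i ≠ 0}
  let D : Matrix ι ι 𝕜 := diagonal fun i => (ev i : 𝕜)
  have hD : D.det ≠ 0 := by
    simp only [D, det_diagonal, Finset.prod_ne_zero_iff]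
    intro i _
    exact_mod_cast i.2
  have key : ∀ a b : n, ev a = 0 → ev b = 0 →
      N.submatrix (fun _ : Unit => a) (fun _ : Unit => b) = 0 ∧
      N.submatrix (fun _ : Unit => a) (Subtype.val : ι → n) * D⁻¹ *
        N.submatrix (Subtype.val : ι → n) (fun _ : Unit => b) = 0 := by
    intro a b ha hb
    refine border_eq_zero_of_det_pencil (A := N.submatrix Subtype.val Subtype.val) hD fun s => ?_
    have h1 : fromBlocks (D + s • N.submatrix (Subtype.val : ι → n) Subtype.val)
        (s • N.submatrix (Subtype.val : ι → n) (fun _ : Unit => b))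
        (s • N.submatrix (fun _ : Unit => a) (Subtype.val : ι → n))
        (s • N.submatrix (fun _ : Unit => a) (fun _ : Unit => b)) =
        ((diagonal fun i => (ev i : 𝕜)) + s • N).submatrix
          (Sum.elim (Subtype.val : ι → n) fun _ : Unit => a)
          (Sum.elim (Subtype.val : ι → n) fun _ : Unit => b) := by
      ext x y
      rcases x with x | x <;> rcases y with y | y
      · have hxy : (x : n) = y ↔ x = y := Subtype.coe_inj
        simp [D, diagonal_apply, hxy]
      · have : (x : n) ≠ b := fun h => x.2 (h ▸ hb)
        simp [this]
      · have : a ≠ (y : n) := fun h => y.2 (h ▸ ha)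
        simp [this]
      · simp [diagonal_apply, ha]
    refine det_eq_zero_of_rank_lt ?_
    rw [h1, Fintype.card_sum, Fintype.card_unit]
    exact Nat.lt_succ_of_le ((rank_submatrix_le _ _ _).trans (hT s))
  by_cases hi : ev i = 0
  · simpa using congrFun₂ (key i j hi hj).1 () ()
  · have h0 := congrFun₂ (key j j hj hj).2 () ()
    have hDinv : D⁻¹ = diagonal fun i : ι => ((ev i : 𝕜))⁻¹ := by
      refine inv_eq_right_inv ?_
      rw [diagonal_mul_diagonal, ← diagonal_one]
      congr 1
      ext i
      exact mul_inv_cancel₀ (by exact_mod_cast i.2)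
    have h1 : ∑ x : ι, (ev x)⁻¹ * ‖N x j‖ ^ 2 = 0 := by
      rw [hDinv, mul_apply] at h0
      simp only [mul_diagonal, submatrix_apply, zero_apply] at h0
      have h2 : ((∑ x : ι, (ev x)⁻¹ * ‖N x j‖ ^ 2 : ℝ) : 𝕜) = 0 := by
        rw [← h0]
        push_cast
        refine Finset.sum_congr rfl fun x _ => ?_
        rw [← RCLike.conj_mul, ← hNherm.apply j x, RCLike.star_def]
        ring
      exact_mod_cast h2
    have hpos : ∀ x : ι, 0 < (ev x)⁻¹ := fun x =>
      inv_pos.2 (lt_of_le_of_ne (hP.eigenvalues_nonneg x) (Ne.symm x.2))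
    have h3 := (Finset.sum_eq_zero_iff_of_nonneg fun x _ =>
      mul_nonneg (hpos x).le (sq_nonneg ‖N x j‖)).1 h1 ⟨i, hi⟩ (Finset.mem_univ _)
    simpa [(hpos ⟨i, hi⟩).ne', hi] using h3

theorem PosSemidef.exists_unitary_forall_apply_eq_zero {k : ℕ} {𝕜 : Type*} [RCLike 𝕜]
    {P : Matrix (Fin k) (Fin k) 𝕜} (hP : P.PosSemidef) :
    ∃ Q ∈ unitaryGroup (Fin k) 𝕜, ∀ M : Matrix (Fin k) (Fin k) 𝕜, M.IsHermitian →
      (∀ s : ℝ, (P + s • M).rank ≤ P.rank) →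
      ∀ i j : Fin k, (P.rank ≤ (i : ℕ) ∨ P.rank ≤ (j : ℕ)) → (Qᴴ * M * Q) i j = 0 := by
  have hk : P.rank ≤ k := by simpa using P.rank_le_card_width
  have hcard : Fintype.card {i : Fin k // (i : ℕ) < P.rank} =
      Fintype.card {i // hP.1.eigenvalues i ≠ 0} := by
    rw [← hP.1.rank_eq_card_non_zero_eigs, Fintype.card_subtype, Fin.card_filter_val_lt,
      min_eq_right hk]
  let σ : Equiv.Perm (Fin k) := (Fintype.equivOfCardEq hcard).extendSubtype
  have hσ : ∀ i : Fin k, P.rank ≤ (i : ℕ) → hP.1.eigenvalues (σ i) = 0 := fun i hi =>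
    not_not.1 ((Fintype.equivOfCardEq hcard).extendSubtype_not_mem i (not_lt.2 hi))
  set U : Matrix (Fin k) (Fin k) 𝕜 := ↑hP.1.eigenvectorUnitary
  have hUU : Uᴴ * U = 1 := Unitary.coe_star_mul_self hP.1.eigenvectorUnitary
  refine ⟨U.submatrix id σ, ?_, fun M hM hrank i j hij => ?_⟩
  · rw [mem_unitaryGroup_iff', star_eq_conjTranspose, conjTranspose_submatrix,
      ← submatrix_mul _ _ σ id σ Function.bijective_id, hUU, submatrix_one_equiv]
  · have hconj : ((U.submatrix id σ)ᴴ * M * U.submatrix id σ) i j =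
        (Uᴴ * M * U) (σ i) (σ j) := by
      simp [mul_apply]
    have hzero : ∀ a b : Fin k, P.rank ≤ (b : ℕ) → (Uᴴ * M * U) (σ a) (σ b) = 0 := fun a b hb =>
      hP.conj_eigenvectorUnitary_apply_eq_zero hM hrank (hσ b hb)
    rw [hconj]
    rcases hij with hi | hj
    · rw [← (isHermitian_conjTranspose_mul_mul U hM).apply, hzero j i hi, star_zero]
    · exact hzero i j hj

end Matrix

/-- Let `V` be an `ℝ`-subspace of hermitian `k×k` matrices all of whose elements have rank
at most `d`, containing a positive semidefinite matrix of rank exactly `d`. Then some unitary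
`Q` conjugates `V` into the matrices supported on the upper-left `d×d` block; if `V` consists
of real symmetric matrices, `Q` can be chosen real orthogonal. -/
theorem unitary_reduction_of_bounded_rank {k d : ℕ}
    (V : Submodule ℝ (Matrix (Fin k) (Fin k) ℂ))
    (hherm : ∀ M ∈ V, M.IsHermitian)
    (hrank : ∀ M ∈ V, M.rank ≤ d)
    (P : Matrix (Fin k) (Fin k) ℂ) (hPV : P ∈ V) (hP : P.PosSemidef) (hPrank : P.rank = d) :
    (∃ Q : Matrix (Fin k) (Fin k) ℂ, Q ∈ Matrix.unitaryGroup (Fin k) ℂ ∧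
      ∀ M ∈ V, ∀ i j : Fin k, (d ≤ (i : ℕ) ∨ d ≤ (j : ℕ)) → (Qᴴ * M * Q) i j = 0) ∧
    ((∀ M ∈ V, ∀ i j : Fin k, (M i j).im = 0) →
      ∃ Q : Matrix (Fin k) (Fin k) ℝ, Q ∈ Matrix.orthogonalGroup (Fin k) ℝ ∧
        ∀ M ∈ V, ∀ i j : Fin k, (d ≤ (i : ℕ) ∨ d ≤ (j : ℕ)) →
          ((Q.map (algebraMap ℝ ℂ))ᴴ * M * Q.map (algebraMap ℝ ℂ)) i j = 0) := by
  have hline : ∀ M ∈ V, ∀ s : ℝ, (P + s • M).rank ≤ P.rank := fun M hM s =>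
    (hrank _ (V.add_mem hPV (V.smul_mem s hM))).trans_eq hPrank.symm
  subst hPrank
  refine ⟨?_, fun hreal => ?_⟩
  · obtain ⟨Q, hQ, h⟩ := hP.exists_unitary_forall_apply_eq_zero
    exact ⟨Q, hQ, fun M hM => h M (hherm M hM) (hline M hM)⟩
  · have hmap : ∀ M ∈ V, (M.map Complex.re).map (algebraMap ℝ ℂ) = M := fun M hM => by
      ext i j
      exact Complex.ext (by simp) (by simp [hreal M hM i j])
    have hherm' : ∀ M ∈ V, (M.map Complex.re).IsHermitian := fun M hM => by
      ext i j
      simpa using congrArg Complex.re ((hherm M hM).apply i j)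
    have hP' : (P.map Complex.re).PosSemidef := by
      refine .of_dotProduct_mulVec_nonneg (hherm' P hPV) fun x => ?_
      have h := (Complex.le_def.1 (hP.dotProduct_mulVec_nonneg fun i => (x i : ℂ))).1
      simpa [dotProduct, mulVec] using h
    have hPrank' : (P.map Complex.re).rank = P.rank := by
      rw [← rank_map_algebraMap (L := ℂ), hmap P hPV]
    obtain ⟨Q, hQ, h⟩ := hP'.exists_unitary_forall_apply_eq_zero
    refine ⟨Q, hQ, fun M hM i j hij => ?_⟩
    have hline' : ∀ s : ℝ, (P.map Complex.re + s • M.map Complex.re).rank ≤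
        (P.map Complex.re).rank := fun s => by
      have hs : P.map Complex.re + s • M.map Complex.re = (P + s • M).map Complex.re := by
        ext i j
        simp
      rw [hPrank', hs, ← rank_map_algebraMap (L := ℂ),
        hmap _ (V.add_mem hPV (V.smul_mem s hM))]
      exact hline M hM s
    have h0 := h _ (hherm' M hM) hline' i j (by rwa [hPrank'])
    have hconj : (Q.map (algebraMap ℝ ℂ))ᴴ * M * Q.map (algebraMap ℝ ℂ) =
        (Qᴴ * M.map Complex.re * Q).map (algebraMap ℝ ℂ) := by
      have hQs : (Q.map (algebraMap ℝ ℂ))ᴴ = Qᴴ.map (algebraMap ℝ ℂ) := by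
        ext i j
        simp
      rw [Matrix.map_mul, Matrix.map_mul, hmap M hM, hQs]
    rw [hconj, map_apply, h0, map_zero]
end

section
/- Let M₁,…,Mₙ be complex hermitian k×k matrices and let p = det(I + x₁M₁ + ⋯ + xₙMₙ) have total degree d. Suppose the spectrahedron S(ℳ) = {a ∈ ℝⁿ : I + a₁M₁ + ⋯ + aₙMₙ ⪰ 0} contains a full-dimensional cone, i.e., there is a nonempty open set U ⊆ ℝⁿ such that t·a ∈ S(ℳ) for all a ∈ U and all t ≥ 0. Then p has a hermitian determinantal representation of size d. If moreover all Mᵢ are real symmetric, then p has a symmetric determinantal representation of size d. -/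
open MvPolynomial Matrix
open scoped ComplexOrder

/-- The monic symmetric linear matrix polynomial over `ℝ`. -/
noncomputable def pencilR {n k : ℕ} (M : Fin n → Matrix (Fin k) (Fin k) ℝ) :
    Matrix (Fin k) (Fin k) (MvPolynomial (Fin n) ℝ) :=
  1 + ∑ i, (M i).map (fun c => MvPolynomial.C c * MvPolynomial.X i)

/-- `p` has a symmetric determinantal representation of size `k`. -/
def HasSymmRep {n : ℕ} (p : MvPolynomial (Fin n) ℝ) (k : ℕ) : Prop :=
  ∃ M : Fin n → Matrix (Fin k) (Fin k) ℝ, (∀ i, (M i).IsSymm) ∧ p = (pencilR M).det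

section LinearPencil

variable {R : Type*} [CommRing R] {n : ℕ} {ι κ : Type*} [DecidableEq ι] [DecidableEq κ]

/-- The monic linear matrix polynomial `1 + ∑ xᵢ Mᵢ` over a commutative ring. -/
noncomputable def linPencil (M : Fin n → Matrix ι ι R) : Matrix ι ι (MvPolynomial (Fin n) R) :=
  1 + ∑ i, (M i).map (fun c => MvPolynomial.C c * MvPolynomial.X i)

lemma linPencil_apply (M : Fin n → Matrix ι ι R) (r s : ι) :
    linPencil M r s = (1 : Matrix ι ι (MvPolynomial (Fin n) R)) r s +
      ∑ i, MvPolynomial.C (M i r s) * MvPolynomial.X i := by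
  simp [linPencil, Matrix.sum_apply]

lemma linPencil_submatrix (M : Fin n → Matrix ι ι R) (e : κ → ι) (he : Function.Injective e) :
    linPencil (fun i => (M i).submatrix e e) = (linPencil M).submatrix e e := by
  ext1 r s
  simp [linPencil_apply, Matrix.one_apply, he.eq_iff]

lemma linPencil_map {S : Type*} [CommRing S] (f : R →+* S) (M : Fin n → Matrix ι ι R) :
    linPencil (fun i => (M i).map f) = (linPencil M).map (MvPolynomial.map f) := by
  ext1 r s
  simp [linPencil_apply, Matrix.one_apply, apply_ite (MvPolynomial.map f)]

variable [Fintype ι]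

lemma linPencil_conj (M : Fin n → Matrix ι ι R) (V W : Matrix ι ι R) (h : V * W = 1) :
    linPencil (fun i => V * M i * W) =
      V.map MvPolynomial.C * linPencil M * W.map MvPolynomial.C := by
  have key (i : Fin n) (A : Matrix ι ι R) :
      A.map (fun c => MvPolynomial.C c * MvPolynomial.X i) =
        (MvPolynomial.X i : MvPolynomial (Fin n) R) • A.map MvPolynomial.C := by
    ext1 r s
    simp [mul_comm]
  have h' : V.map MvPolynomial.C * W.map MvPolynomial.C =
      (1 : Matrix ι ι (MvPolynomial (Fin n) R)) := by
    rw [← Matrix.map_mul, h, Matrix.map_one _ MvPolynomial.C_0 MvPolynomial.C_1]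
  simp only [linPencil, key, mul_add, add_mul, mul_one, h', Finset.mul_sum, Finset.sum_mul,
    Matrix.map_mul, Matrix.mul_smul, Matrix.smul_mul]

lemma det_linPencil_conj (M : Fin n → Matrix ι ι R) (V W : Matrix ι ι R) (h : V * W = 1) :
    (linPencil (fun i => V * M i * W)).det = (linPencil M).det := by
  rw [linPencil_conj M V W h, Matrix.det_mul_right_comm, ← Matrix.map_mul, h,
    Matrix.map_one _ MvPolynomial.C_0 MvPolynomial.C_1, one_mul]

lemma det_linPencil_eq_of_columns_zero (M : Fin n → Matrix ι ι R) (P : ι → Prop)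
    [DecidablePred P] (hcol : ∀ i r s, ¬ P s → M i r s = 0) :
    (linPencil M).det =
      (linPencil (fun i => (M i).submatrix (Subtype.val : {j // P j} → ι) Subtype.val)).det := by
  rw [Matrix.twoBlockTriangular_det' _ P, linPencil_submatrix _ _ Subtype.val_injective]
  · have : (linPencil M).toSquareBlockProp (fun i => ¬ P i) = 1 := by
      ext1 r s
      simp [Matrix.toSquareBlockProp_def, linPencil_apply, hcol _ _ _ s.2, Matrix.one_apply,
        Subtype.ext_iff]
    rw [this, Matrix.det_one, mul_one]
    rfl
  · intro r hr s hs
    have hrs : r ≠ s := fun h => hs (h ▸ hr)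
    simp [linPencil_apply, hcol _ _ _ hs, hrs]

lemma totalDegree_det_linPencil_le (M : Fin n → Matrix ι ι R) :
    (linPencil M).det.totalDegree ≤ Fintype.card ι := by
  rw [Matrix.det_apply]
  refine MvPolynomial.totalDegree_finsetSum_le fun σ _ => ?_
  refine (MvPolynomial.totalDegree_smul_le _ _).trans ?_
  refine (MvPolynomial.totalDegree_finsetProd _ _).trans ?_
  refine (Finset.sum_le_card_nsmul _ _ 1 fun r _ => ?_).trans (by simp)
  rw [linPencil_apply]
  refine (MvPolynomial.totalDegree_add _ _).trans (max_le ?_ ?_)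
  · rw [Matrix.one_apply]
    split_ifs <;> simp
  · refine MvPolynomial.totalDegree_finsetSum_le fun i _ => ?_
    rw [MvPolynomial.C_mul_X_eq_monomial]
    exact (MvPolynomial.totalDegree_monomial_le _ _).trans (by simp)

lemma card_le_totalDegree_det_linPencil [IsDomain R] (M : Fin n → Matrix ι ι R) (a : Fin n → R)
    (l : ι → R) (hl : ∀ j, l j ≠ 0) (hM : ∑ i, a i • M i = Matrix.diagonal l) :
    Fintype.card ι ≤ (linPencil M).det.totalDegree := by
  let φ := MvPolynomial.aeval (R := R) (fun i => Polynomial.C (a i) * Polynomial.X)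
  have hmap : (linPencil M).map φ =
      Matrix.diagonal (fun j => Polynomial.C (l j) * Polynomial.X + Polynomial.C 1) := by
    ext1 r s
    have hrs := congrFun (congrFun hM r) s
    simp only [Matrix.sum_apply, Matrix.smul_apply, smul_eq_mul] at hrs
    have hsum : φ (∑ i, MvPolynomial.C (M i r s) * MvPolynomial.X i) =
        Polynomial.C (Matrix.diagonal l r s) * Polynomial.X := by
      rw [← hrs, map_sum, map_sum, Finset.sum_mul]
      refine Finset.sum_congr rfl fun i _ => ?_
      simp only [φ, map_mul, MvPolynomial.aeval_X, MvPolynomial.algHom_C,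
        Polynomial.algebraMap_eq]
      ring
    rw [Matrix.map_apply, linPencil_apply, map_add, hsum]
    by_cases h : r = s
    · subst h
      simp [add_comm]
    · simp [h]
  have hdet : φ (linPencil M).det =
      ∏ j, (Polynomial.C (l j) * Polynomial.X + Polynomial.C 1) := by
    rw [AlgHom.map_det, AlgHom.mapMatrix_apply, hmap, Matrix.det_diagonal]
  have hdeg : (φ (linPencil M).det).natDegree = Fintype.card ι := by
    have hd (j : ι) : (Polynomial.C (l j) * Polynomial.X + Polynomial.C 1).natDegree = 1 :=
      Polynomial.natDegree_linear (hl j)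
    rw [hdet, Polynomial.natDegree_prod _ _ fun j _ h => by
      have := hd j
      rw [h, Polynomial.natDegree_zero] at this
      exact zero_ne_one this]
    simp only [hd, Finset.sum_const, Finset.card_univ, smul_eq_mul, mul_one]
  have := MvPolynomial.aeval_natDegree_le (linPencil M).det le_rfl
    (fun i => Polynomial.C (a i) * Polynomial.X) (n := 1)
    (fun i => (Polynomial.natDegree_C_mul_le _ _).trans Polynomial.natDegree_X_le)
  rw [← hdeg]
  simpa using this

end LinearPencil

section RCLike

variable {𝕜 : Type*} [RCLike 𝕜] {n k : ℕ}

/-- If a real combination of the coefficients of a monic hermitian pencil has its kernel contained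
in the kernel of each coefficient, then the determinant of the pencil has a hermitian
representation whose size is its degree. -/
lemma exists_small_rep_of_ker_le (M : Fin n → Matrix (Fin k) (Fin k) 𝕜)
    (hM : ∀ i, (M i).IsHermitian) (a : Fin n → ℝ)
    (hker : ∀ v, (∑ i, a i • M i) *ᵥ v = 0 → ∀ i, M i *ᵥ v = 0) :
    ∃ N : Fin n → Matrix (Fin (linPencil M).det.totalDegree)
        (Fin (linPencil M).det.totalDegree) 𝕜,
      (∀ i, (N i).IsHermitian) ∧ (linPencil M).det = (linPencil N).det := by
  classical
  have hA : (∑ i, a i • M i).IsHermitian := by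
    rw [Matrix.IsHermitian, Matrix.conjTranspose_sum]
    exact Finset.sum_congr rfl fun i _ => by
      rw [Matrix.conjTranspose_smul, hM i, star_trivial]
  let W : Matrix (Fin k) (Fin k) 𝕜 := hA.eigenvectorUnitary
  have hW : Wᴴ * W = 1 := Unitary.coe_star_mul_self hA.eigenvectorUnitary
  let K : Fin n → Matrix (Fin k) (Fin k) 𝕜 := fun i => Wᴴ * M i * W
  have hK (i) : (K i).IsHermitian := Matrix.isHermitian_conjTranspose_mul_mul W (hM i)
  have hdiag : ∑ i, (a i : 𝕜) • K i =
      Matrix.diagonal (fun j => (hA.eigenvalues j : 𝕜)) := by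
    have h := hA.conjStarAlgAut_star_eigenvectorUnitary
    rw [Unitary.conjStarAlgAut_star_apply] at h
    have h2 : Wᴴ * (∑ i, a i • M i) * W = ∑ i, (a i : 𝕜) • K i := by
      simp only [K, Finset.mul_sum, Finset.sum_mul, Matrix.mul_smul, Matrix.smul_mul]
      exact Finset.sum_congr rfl fun i _ => RCLike.real_smul_eq_coe_smul _ _
    rw [← h2]
    exact h
  let P : Fin k → Prop := fun j => hA.eigenvalues j ≠ 0
  have hcol (i : Fin n) (r s : Fin k) (hs : ¬ P s) : K i r s = 0 := by
    have h0 : (∑ i, a i • M i) *ᵥ (hA.eigenvectorBasis s).ofLp = 0 := by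
      rw [hA.mulVec_eigenvectorBasis, not_not.mp hs, zero_smul]
    have h1 := hker _ h0 i
    rw [← hA.eigenvectorUnitary_mulVec] at h1
    have h2 : K i *ᵥ Pi.single s 1 = 0 := by
      simp only [K, ← Matrix.mulVec_mulVec]
      rw [show W *ᵥ Pi.single s 1 = _ from rfl, h1, Matrix.mulVec_zero]
    simpa using congrFun h2 r
  let L : Fin n → Matrix {j // P j} {j // P j} 𝕜 :=
    fun i => (K i).submatrix Subtype.val Subtype.val
  have hdet : (linPencil M).det = (linPencil L).det := by
    rw [← det_linPencil_conj M _ _ hW]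
    exact det_linPencil_eq_of_columns_zero K P hcol
  have hL : ∑ i, (a i : 𝕜) • L i =
      Matrix.diagonal (fun j : {j // P j} => (hA.eigenvalues j : 𝕜)) := by
    ext1 r s
    have := congrFun (congrFun hdiag r.1) s.1
    simpa [L, Matrix.sum_apply, Matrix.diagonal_apply, Subtype.ext_iff] using this
  have hcard : Fintype.card {j // P j} = (linPencil M).det.totalDegree := by
    rw [hdet]
    refine le_antisymm (card_le_totalDegree_det_linPencil L _ _ (fun j => ?_) hL)
      (totalDegree_det_linPencil_le L)
    exact_mod_cast j.2
  let e := (Fintype.equivFinOfCardEq hcard).symm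
  refine ⟨fun i => (L i).submatrix e e, fun i => ((hK i).submatrix _).submatrix _, ?_⟩
  rw [linPencil_submatrix _ _ e.injective, Matrix.det_submatrix_equiv_self]
  exact hdet

lemma posSemidef_of_forall_one_add_smul {A : Matrix (Fin k) (Fin k) 𝕜} (hA : A.IsHermitian)
    (h : ∀ t : ℝ, 0 ≤ t → (1 + t • A).PosSemidef) : A.PosSemidef := by
  refine Matrix.posSemidef_iff_dotProduct_mulVec.2 ⟨hA, fun x => ?_⟩
  have hreal (B : Matrix (Fin k) (Fin k) 𝕜) (hB : B.IsHermitian) :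
      RCLike.im (star x ⬝ᵥ B *ᵥ x) = 0 := hB.im_star_dotProduct_mulVec_self x
  refine RCLike.nonneg_iff.2 ⟨?_, hreal A hA⟩
  by_contra! hneg
  set q := RCLike.re (star x ⬝ᵥ A *ᵥ x)
  set c := RCLike.re (star x ⬝ᵥ x)
  have hc : 0 ≤ c := (RCLike.nonneg_iff.1 (dotProduct_star_self_nonneg x)).1
  have key (t : ℝ) (ht : 0 ≤ t) : 0 ≤ c + t * q := by
    have := (RCLike.nonneg_iff.1 ((Matrix.posSemidef_iff_dotProduct_mulVec.1 (h t ht)).2 x)).1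
    simpa [Matrix.add_mulVec, Matrix.smul_mulVec, dotProduct_add, dotProduct_smul,
      RCLike.smul_re] using this
  have := key ((c + 1) / (-q)) (div_nonneg (by linarith) (by linarith))
  rw [div_mul_eq_mul_div, div_neg, mul_div_assoc, div_self hneg.ne] at this
  linarith

lemma mulVec_eq_zero_of_posSemidef_add_sub {A B : Matrix (Fin k) (Fin k) 𝕜} {ε : ℝ} (hε : 0 < ε)
    (h₁ : (A + ε • B).PosSemidef) (h₂ : (A - ε • B).PosSemidef) {v : Fin k → 𝕜}
    (hv : A *ᵥ v = 0) : B *ᵥ v = 0 := by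
  have e₁ : (A + ε • B) *ᵥ v = ε • (B *ᵥ v) := by
    rw [Matrix.add_mulVec, hv, zero_add, Matrix.smul_mulVec]
  have e₂ : (A - ε • B) *ᵥ v = -(ε • (B *ᵥ v)) := by
    rw [Matrix.sub_mulVec, hv, zero_sub, Matrix.smul_mulVec]
  have p₁ := (Matrix.posSemidef_iff_dotProduct_mulVec.1 h₁).2 v
  have p₂ := (Matrix.posSemidef_iff_dotProduct_mulVec.1 h₂).2 v
  rw [e₁] at p₁
  rw [e₂, dotProduct_neg, neg_nonneg] at p₂
  have h := (h₁.dotProduct_mulVec_zero_iff v).1 (by rw [e₁]; exact le_antisymm p₂ p₁)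
  rw [e₁] at h
  exact (smul_eq_zero.1 h).resolve_left hε.ne'

lemma exists_small_rep_of_cone (M : Fin n → Matrix (Fin k) (Fin k) 𝕜)
    (hM : ∀ i, (M i).IsHermitian) (U : Set (Fin n → ℝ)) (hUopen : IsOpen U) (hUne : U.Nonempty)
    (hcone : ∀ a ∈ U, ∀ t : ℝ, 0 ≤ t → (1 + t • ∑ i, a i • M i).PosSemidef) :
    ∃ N : Fin n → Matrix (Fin (linPencil M).det.totalDegree)
        (Fin (linPencil M).det.totalDegree) 𝕜,
      (∀ i, (N i).IsHermitian) ∧ (linPencil M).det = (linPencil N).det := by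
  obtain ⟨a, ha⟩ := hUne
  have hpsd (b : Fin n → ℝ) (hb : b ∈ U) : (∑ i, b i • M i).PosSemidef := by
    refine posSemidef_of_forall_one_add_smul ?_ (hcone b hb)
    rw [Matrix.IsHermitian, Matrix.conjTranspose_sum]
    exact Finset.sum_congr rfl fun i _ => by
      rw [Matrix.conjTranspose_smul, hM i, star_trivial]
  obtain ⟨ε, hε, hball⟩ := Metric.isOpen_iff.1 hUopen a ha
  refine exists_small_rep_of_ker_le M hM a fun v hv i => ?_
  have hmem (s : ℝ) (hs : |s| < ε) : a + Pi.single i s ∈ U := by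
    refine hball ?_
    rw [mem_ball_iff_norm, add_sub_cancel_left, Pi.norm_single]
    exact hs
  have hsum (s : ℝ) : ∑ j, (a + Pi.single i s : Fin n → ℝ) j • M j =
      ∑ j, a j • M j + s • M i := by
    simp [add_smul, Finset.sum_add_distrib, Pi.single_apply, ite_smul]
  have hε' : |ε / 2| < ε := by rw [abs_of_pos (half_pos hε)]; exact half_lt_self hε
  refine mulVec_eq_zero_of_posSemidef_add_sub (half_pos hε) ?_ ?_ hv
  · rw [← hsum]
    exact hpsd _ (hmem _ hε')
  · rw [sub_eq_add_neg, ← neg_smul, ← hsum]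
    exact hpsd _ (hmem _ (by rwa [abs_neg]))

end RCLike

lemma posSemidef_of_map_ofReal {k : ℕ} {A : Matrix (Fin k) (Fin k) ℝ}
    (h : (A.map (algebraMap ℝ ℂ)).PosSemidef) : A.PosSemidef := by
  obtain ⟨hA, hpos⟩ := Matrix.posSemidef_iff_dotProduct_mulVec.1 h
  refine Matrix.posSemidef_iff_dotProduct_mulVec.2 ⟨?_, fun x => ?_⟩
  · ext r s
    have := congrFun (congrFun hA r) s
    simpa using this
  · have hx := hpos (fun j => (x j : ℂ))
    have hstar : star (fun j => (x j : ℂ)) = algebraMap ℝ ℂ ∘ star x := by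
      ext j
      simp
    have hmul : A.map (algebraMap ℝ ℂ) *ᵥ (fun j => (x j : ℂ)) =
        algebraMap ℝ ℂ ∘ (A *ᵥ x) := by
      ext j
      exact ((algebraMap ℝ ℂ).map_mulVec A x j).symm
    rw [hstar, hmul, ← RingHom.map_dotProduct] at hx
    exact Complex.zero_le_real.1 hx

/-- If the spectrahedron of a monic hermitian pencil with determinant `p` of degree `d`
contains a full-dimensional cone, then `p` has a hermitian determinantal representation of
size `d`; if moreover all coefficient matrices are real (symmetric), then `p` has a symmetric
determinantal representation of size `d`. -/
theorem small_rep_of_cone {n k : ℕ} (M : Fin n → Matrix (Fin k) (Fin k) ℂ)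
    (hM : ∀ i, (M i).IsHermitian)
    (p : MvPolynomial (Fin n) ℝ)
    (hp : MvPolynomial.map (algebraMap ℝ ℂ) p = (pencil M).det)
    (d : ℕ) (hd : p.totalDegree = d)
    (U : Set (Fin n → ℝ)) (hUopen : IsOpen U) (hUne : U.Nonempty)
    (hcone : ∀ a ∈ U, ∀ t : ℝ, 0 ≤ t →
      (1 + ∑ i, ((t * a i : ℝ) : ℂ) • M i).PosSemidef) :
    HasHermRep p d ∧
    ((∀ i, ∀ r s : Fin k, ((M i) r s).im = 0) → HasSymmRep p d) := by
  have hsmul (a : Fin n → ℝ) (t : ℝ) :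
      ∑ i, ((t * a i : ℝ) : ℂ) • M i = t • ∑ i, a i • M i := by
    rw [Finset.smul_sum]
    exact Finset.sum_congr rfl fun i _ => by rw [smul_smul]; rfl
  simp only [hsmul] at hcone
  have hinj : Function.Injective (MvPolynomial.map (σ := Fin n) (algebraMap ℝ ℂ)) :=
    MvPolynomial.map_injective _ (algebraMap ℝ ℂ).injective
  subst hd
  constructor
  · obtain ⟨N, hN, hdet⟩ := exists_small_rep_of_cone M hM U hUopen hUne hcone
    have hdeg : (linPencil M).det.totalDegree = p.totalDegree := by
      rw [show (linPencil M).det = _ from hp.symm]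
      rw [MvPolynomial.totalDegree, MvPolynomial.support_map_of_injective p (algebraMap ℝ ℂ).injective]
      rfl
    rw [← hdeg]
    exact ⟨N, hN, hp.trans hdet⟩
  · intro him
    let Q : Fin n → Matrix (Fin k) (Fin k) ℝ := fun i => (M i).map Complex.re
    have hQ (i) : (Q i).map (algebraMap ℝ ℂ) = M i := by
      ext r s
      exact Complex.ext (by simp [Q]) (by simp [him])
    have hQherm (i) : (Q i).IsHermitian := by
      ext r s
      simpa [Q] using congrArg Complex.re (congrFun (congrFun (hM i) r) s)
    have hQp : p = (linPencil Q).det := by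
      apply hinj
      rw [hp, RingHom.map_det, RingHom.mapMatrix_apply, ← linPencil_map]
      simp only [hQ]
      rfl
    have hQcone (a) (ha : a ∈ U) (t : ℝ) (ht : 0 ≤ t) :
        (1 + t • ∑ i, a i • Q i).PosSemidef := by
      apply posSemidef_of_map_ofReal
      convert hcone a ha t ht using 1
      simp only [← hQ]
      ext r s
      simp [Matrix.sum_apply, Matrix.one_apply, apply_ite]
    obtain ⟨N, hN, hdet⟩ := exists_small_rep_of_cone Q hQherm U hUopen hUne hQcone
    rw [hQp]
    exact ⟨N, fun i => by simpa [Matrix.IsSymm, Matrix.IsHermitian] using hN i, hdet⟩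
end

section
/- Let ℳ = I + x₁M₁ + ⋯ + xₙMₙ be a monic linear matrix polynomial of size k with all Mᵢ real symmetric, whose spectrahedron S(ℳ) ⊆ ℝⁿ does not contain a full line. Let d be the total degree of p = det ℳ and assume n > d(d+1)/2. If d is even then k ≥ 2n/d + (d−2)/4; if d is odd then k ≥ 2(n−1)/(d−1) + (d−3)/4 (inequalities of real numbers). -/
open MvPolynomial Matrix

open Finset

theorem eq_zero_of_partial_injection_kernel {V : Type*} [Fintype V] [DecidableEq V]
    (S : Finset V) (f : V → V) (hf : Set.InjOn f S) (δ : V → ℝ) (hδ : ∀ x, 0 < δ x)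
    (hinj : Function.Injective fun T : Finset V => ∏ x ∈ T, δ x) (v : V → ℝ)
    (hvS : ∀ x, v x ≠ 0 → x ∈ S)
    (hv : ∀ x ∈ S, δ x * v x + ∑ y, (if y ∈ S ∧ f y ∈ S ∧ f (f y) = x then δ (f y) * v y else 0) = 0) :
    v = 0 := by
  set T : Finset V := univ.filter fun x => v x ≠ 0 with hT
  have memT : ∀ x, x ∈ T ↔ v x ≠ 0 := by simp [hT]
  have hffinj : ∀ y ∈ S, f y ∈ S → ∀ z ∈ S, f z ∈ S → f (f y) = f (f z) → y = z :=
    fun y hy hfy z hz hfz h => hf hy hz (hf hfy hfz h)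
  have hsub : T ⊆ (T.filter fun y => f y ∈ S).image fun y => f (f y) := by
    intro x hx
    by_contra hcon
    have hx' := (memT x).1 hx
    have h := hv x (hvS x hx')
    rw [Finset.sum_eq_zero, add_zero] at h
    · exact mul_ne_zero (hδ x).ne' hx' h
    · intro y _
      split_ifs with hy
      · by_cases hvy : v y = 0
        · simp [hvy]
        · exact absurd (mem_image.2 ⟨y, mem_filter.2 ⟨(memT y).2 hvy, hy.2.1⟩, hy.2.2⟩) hcon
      · rfl
  have hfilt : T.filter (fun y => f y ∈ S) = T :=
    eq_of_subset_of_card_le (filter_subset _ _)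
      ((card_le_card hsub).trans card_image_le)
  rw [hfilt] at hsub
  have hfS : ∀ y ∈ T, f y ∈ S := fun y hy => filter_eq_self.1 hfilt y hy
  have hTS : ∀ y ∈ T, y ∈ S := fun y hy => hvS y ((memT y).1 hy)
  have hTim : T = T.image fun y => f (f y) := eq_of_subset_of_card_le hsub card_image_le
  have hffT : ∀ y ∈ T, f (f y) ∈ T := fun y hy => by
    rw [hTim]; exact mem_image_of_mem _ hy
  have heq : ∀ y ∈ T, δ (f (f y)) * v (f (f y)) + δ (f y) * v y = 0 := by
    intro y hy
    have h := hv _ (hTS _ (hffT y hy))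
    rw [Finset.sum_eq_single y] at h
    · simpa [hTS y hy, hfS y hy] using h
    · intro z _ hzy
      rw [if_neg]
      rintro ⟨h1, h2, h3⟩
      exact hzy (hffinj z h1 h2 y (hTS y hy) (hfS y hy) h3)
    · simp
  have key : ∀ U ⊆ T, (∀ y ∈ U, f (f y) ∈ U) → U.image f = U := by
    intro U hU hUU
    have hinjU : Set.InjOn (fun y => f (f y)) U := fun y hy z hz h =>
      hffinj y (hTS y (hU hy)) (hfS y (hU hy)) z (hTS z (hU hz)) (hfS z (hU hz)) h
    have hUim : U.image (fun y => f (f y)) = U :=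
      eq_of_subset_of_card_le (fun x hx => by
        obtain ⟨y, hy, rfl⟩ := mem_image.1 hx
        exact hUU y hy) (card_image_of_injOn hinjU).ge
    have hfU : Set.InjOn f U := fun y hy z hz h => hf (hTS y (hU hy)) (hTS z (hU hz)) h
    apply hinj
    change ∏ x ∈ U.image f, δ x = ∏ x ∈ U, δ x
    rw [prod_image hfU]
    have h1 : ∏ x ∈ U, (δ x * |v x|) = ∏ y ∈ U, (δ (f y) * |v y|) := by
      conv_lhs => rw [← hUim]
      rw [prod_image hinjU]
      refine prod_congr rfl fun y hy => ?_
      have h := heq y (hU hy)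
      have h2 : δ (f (f y)) * v (f (f y)) = -(δ (f y) * v y) := by linarith
      have h3 := congrArg abs h2
      rwa [abs_neg, abs_mul, abs_mul, abs_of_pos (hδ _), abs_of_pos (hδ _)] at h3
    rw [prod_mul_distrib, prod_mul_distrib] at h1
    refine (mul_right_cancel₀ ?_ h1).symm
    exact prod_ne_zero_iff.2 fun x hx => abs_ne_zero.2 ((memT x).1 (hU hx))
  have hfT : ∀ y ∈ T, f y ∈ T := fun y hy => by
    have := key T subset_rfl hffT
    rw [← this]; exact mem_image_of_mem _ hy
  have hsign : ∀ y ∈ T, (0 < v y * v (f y) → v (f y) * v (f (f y)) < 0) ∧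
      (v y * v (f y) < 0 → 0 < v (f y) * v (f (f y))) := by
    intro y hy
    have h := heq y hy
    have e : δ (f (f y)) * (v (f y) * v (f (f y))) = -(δ (f y) * (v y * v (f y))) := by
      linear_combination v (f y) * h
    constructor
    · intro hp
      have := mul_pos (hδ (f y)) hp
      by_contra hc
      have := mul_nonneg (hδ (f (f y))).le (not_lt.1 hc)
      linarith
    · intro hp
      have := mul_neg_of_pos_of_neg (hδ (f y)) hp
      by_contra hc
      have := mul_nonpos_of_nonneg_of_nonpos (hδ (f (f y))).le (not_lt.1 hc)
      linarith
  set U := T.filter fun y => 0 < v y * v (f y) with hUdef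
  have hU := key U (filter_subset _ _) (by
    intro y hy
    rw [hUdef, mem_filter] at hy ⊢
    exact ⟨hffT y hy.1, (hsign _ (hfT y hy.1)).2 ((hsign y hy.1).1 hy.2)⟩)
  have hUempty : ∀ y, y ∉ U := by
    intro y hy
    have h1 : f y ∈ U := by rw [← hU]; exact mem_image_of_mem _ hy
    rw [hUdef, mem_filter] at hy h1
    exact lt_asymm ((hsign y hy.1).1 hy.2) h1.2
  funext x
  by_contra hx
  have hxT := (memT x).2 hx
  have hq : v x * v (f x) ≠ 0 := mul_ne_zero hx ((memT _).1 (hfT x hxT))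
  rcases lt_or_gt_of_ne hq with h | h
  · exact hUempty (f x) (mem_filter.2 ⟨hfT x hxT, (hsign x hxT).2 h⟩)
  · exact hUempty x (mem_filter.2 ⟨hxT, h⟩)

theorem exists_symm_of_partial_injection {k : ℕ} (S : Finset (Fin k)) (f : Fin k → Fin k)
    (hf : Set.InjOn f S) :
    ∃ X : Matrix (Fin k) (Fin k) ℝ, (∀ p q, X p q = X q p) ∧
      (∀ p q, X p q ≠ 0 → (p ∈ S ∧ f p = q) ∨ (q ∈ S ∧ f q = p)) ∧
      (X.submatrix (fun x : S => (x : Fin k)) (fun y : S => f y)).det ≠ 0 := by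
  set δ : Fin k → ℝ := fun x => 2 ^ (2 ^ (x : ℕ)) with hδdef
  have hδ : ∀ x, 0 < δ x := fun x => by positivity
  have hinj : Function.Injective fun T : Finset (Fin k) => ∏ x ∈ T, δ x := by
    intro T T' h
    simp only [hδdef, prod_pow_eq_pow_sum] at h
    have h1 := pow_right_injective₀ (by norm_num : (0 : ℝ) < 2) (by norm_num) h
    have h2 : ∑ i ∈ T.map Fin.valEmbedding, 2 ^ i = ∑ i ∈ T'.map Fin.valEmbedding, 2 ^ i := by
      simpa [sum_map] using h1
    exact map_injective _ (geomSum_injective le_rfl h2)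
  refine ⟨Matrix.of fun p q => (if p ∈ S ∧ f p = q then δ p else 0) +
    (if q ∈ S ∧ f q = p then δ q else 0), fun p q => add_comm _ _, ?_, ?_⟩
  · intro p q h
    by_contra hc
    rw [not_or] at hc
    exact h (by rw [Matrix.of_apply, if_neg hc.1, if_neg hc.2, add_zero])
  · intro hdet
    obtain ⟨v, hv0, hv⟩ := Matrix.exists_mulVec_eq_zero_iff.2 hdet
    apply hv0
    set w : Fin k → ℝ := fun x => if h : x ∈ S then v ⟨x, h⟩ else 0 with hw
    have hwv : ∀ x : S, w x = v x := fun x => by simp [hw]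
    have key := eq_zero_of_partial_injection_kernel S f hf δ hδ hinj w
      (fun x hx => by by_contra hc; exact hx (by simp [hw, hc])) ?_
    · funext x
      rw [← hwv, key]; rfl
    intro x hx
    have h := congrFun hv ⟨x, hx⟩
    simp only [Matrix.mulVec, dotProduct, Matrix.submatrix_apply, Matrix.of_apply, add_mul,
      sum_add_distrib, Pi.zero_apply, ← hwv] at h
    rw [sum_coe_sort S fun y => (if x ∈ S ∧ f x = f y then δ x else 0) * w y,
      sum_coe_sort S fun y => (if f y ∈ S ∧ f (f y) = x then δ (f y) else 0) * w y,
      sum_eq_single x] at h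
    · rw [if_pos ⟨hx, rfl⟩] at h
      refine Eq.trans ?_ h
      congr 1
      rw [← sum_filter_add_sum_filter_not univ (· ∈ S), sum_eq_zero (s := univ.filter (· ∉ S)),
        add_zero, filter_mem_eq_inter, univ_inter]
      · refine sum_congr rfl fun y hy => ?_
        simp [hy]
      · intro y hy
        exact if_neg fun h' => (mem_filter.1 hy).2 h'.1
    · intro y hy hyx
      rw [if_neg, zero_mul]
      rintro ⟨-, h2⟩
      exact hyx (hf hx hy h2).symm
    · exact fun h => absurd hx h

theorem exists_leading_positions {k d : ℕ} (W : Submodule ℝ (Matrix (Fin k) (Fin k) ℝ))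
    (hsymm : ∀ A ∈ W, ∀ p q, A p q = A q p) (hrank : ∀ A ∈ W, A.rank ≤ d) :
    ∃ G : Finset (Fin k × Fin k), Module.finrank ℝ W ≤ #G ∧ (∀ π ∈ G, π.1 ≤ π.2) ∧
      ∀ X : Matrix (Fin k) (Fin k) ℝ, (∀ p q, X p q = X q p) →
        (∀ p q, p ≤ q → X p q ≠ 0 → (p, q) ∈ G) →
        ∀ (ι : Type) [Fintype ι] [DecidableEq ι] (e₁ e₂ : ι → Fin k),
          (X.submatrix e₁ e₂).det ≠ 0 → Fintype.card ι ≤ d := by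
  classical
  set lead : Fin k × Fin k → Matrix (Fin k) (Fin k) ℝ → Prop := fun π A =>
    A π.1 π.2 = 1 ∧ ∀ p q, p ≤ q → toLex (p, q) < toLex π → A p q = 0 with hlead
  set G : Finset (Fin k × Fin k) := univ.filter fun π => π.1 ≤ π.2 ∧ ∃ A ∈ W, lead π A with hG
  refine ⟨G, ?_, fun π hπ => (mem_filter.1 hπ).2.1, ?_⟩
  · by_contra! hlt
    let φ : W →ₗ[ℝ] (G → ℝ) :=
      { toFun := fun A π => A.1 π.1.1 π.1.2
        map_add' := fun _ _ => rfl
        map_smul' := fun _ _ => rfl }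
    have hker : LinearMap.ker φ ≠ ⊥ := by
      apply LinearMap.ker_ne_bot_of_finrank_lt
      simpa using hlt
    obtain ⟨A, hA, hA0⟩ := Submodule.exists_mem_ne_zero_of_ne_bot hker
    set Q : Finset (Lex (Fin k × Fin k)) :=
      univ.filter fun π => (ofLex π).1 ≤ (ofLex π).2 ∧ A.1 (ofLex π).1 (ofLex π).2 ≠ 0 with hQ
    have hQne : Q.Nonempty := by
      by_contra hc
      rw [not_nonempty_iff_eq_empty] at hc
      have hle : ∀ p q, p ≤ q → A.1 p q = 0 := by
        intro p q hpq
        by_contra h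
        have : toLex (p, q) ∈ Q := by rw [hQ, mem_filter]; exact ⟨mem_univ _, hpq, h⟩
        rw [hc] at this
        exact absurd this (notMem_empty _)
      apply hA0
      apply Subtype.ext
      ext p q
      rcases le_total p q with h | h
      · exact hle p q h
      · rw [hsymm _ A.2]; exact hle q p h
    set π := Q.min' hQne with hπ
    have hπQ : π ∈ Q := Q.min'_mem hQne
    rw [hQ, mem_filter] at hπQ
    have hπG : ofLex π ∈ G := by
      rw [hG, mem_filter]
      refine ⟨mem_univ _, hπQ.2.1, (A.1 (ofLex π).1 (ofLex π).2)⁻¹ • A.1, W.smul_mem _ A.2, ?_, ?_⟩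
      · exact inv_mul_cancel₀ hπQ.2.2
      · intro p q hpq hlt
        by_contra h
        have h0 : A.1 p q ≠ 0 := fun h0 => h (by simp [h0])
        have : toLex (p, q) ∈ Q := by rw [hQ, mem_filter]; exact ⟨mem_univ _, hpq, h0⟩
        exact absurd (Q.min'_le _ this) (not_le.2 hlt)
    exact hπQ.2.2 (congrFun hA ⟨ofLex π, hπG⟩)
  · intro X hX hXG ι _ _ e₁ e₂ hdet
    have hex : ∀ π, ∃ A ∈ W, π ∈ G → lead π A := by
      intro π
      by_cases h : π ∈ G
      · obtain ⟨-, -, A, hA, h'⟩ := mem_filter.1 h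
        exact ⟨A, hA, fun _ => h'⟩
      · exact ⟨0, W.zero_mem, fun h' => absurd h' h⟩
    choose B hBW hB using hex
    set b : Fin k → ℕ := fun i => 2 ^ (k - (i : ℕ)) with hb
    have hbanti : ∀ i j : Fin k, i < j → 2 * b j ≤ b i := by
      intro i j hij
      have : (i : ℕ) < j := hij
      have hj := j.2
      simp only [hb]
      rw [← pow_succ']
      exact Nat.pow_le_pow_right (by norm_num) (by omega)
    have hbpos : ∀ i, 0 < b i := fun i => by positivity
    have hw : ∀ π ∈ G, ∀ p q, B π p q ≠ 0 → p ≤ q → π ≠ (p, q) →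
        b p + b q < b π.1 + b π.2 := by
      rintro ⟨i, j⟩ hπ p q hne hpq hneq
      have hlt : toLex (i, j) < toLex (p, q) := by
        rcases lt_trichotomy (toLex (i, j)) (toLex (p, q)) with h | h | h
        · exact h
        · exact absurd (toLex.injective h) hneq
        · exact absurd ((hB _ hπ).2 p q hpq h) hne
      rw [Prod.Lex.toLex_lt_toLex] at hlt
      have hbp := hbpos j
      have hqp : b q ≤ b p := by
        rcases hpq.lt_or_eq with h | h
        · have := hbanti _ _ h; omega
        · rw [h]
      rcases hlt with h | ⟨h1, h2⟩
      · have := hbanti _ _ h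
        dsimp only at *
        omega
      · have := hbanti _ _ h2
        have := hbpos q
        dsimp only at *
        subst h1
        omega
    have hBsymm : ∀ π p q, B π p q = B π q p := fun π => hsymm _ (hBW π)
    have hw' : ∀ π ∈ G, ∀ p q, B π p q ≠ 0 → b p + b q ≤ b π.1 + b π.2 := by
      intro π hπ p q hne
      rcases le_total p q with h | h
      · by_cases he : π = (p, q)
        · rw [he]
        · exact (hw π hπ p q hne h he).le
      · rw [hBsymm] at hne
        by_cases he : π = (q, p)
        · rw [he, add_comm]
        · rw [add_comm]; exact (hw π hπ q p hne h he).le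
    set N : ℝ → Matrix (Fin k) (Fin k) ℝ := fun τ => Matrix.of fun p q =>
      ∑ π ∈ G, X π.1 π.2 * τ ^ (b π.1 + b π.2 - (b p + b q)) * B π p q with hN
    have hNX : N 0 = X := by
      have hle : ∀ p q, p ≤ q → N 0 p q = X p q := by
        intro p q hpq
        simp only [hN, Matrix.of_apply]
        rw [sum_eq_single (p, q)]
        · by_cases h : (p, q) ∈ G
          · simp [(hB _ h).1]
          · have : X p q = 0 := by
              by_contra hc
              exact h (hXG p q hpq hc)
            simp [this]
        · intro π hπ hne
          by_cases h0 : B π p q = 0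
          · simp [h0]
          · have := hw π hπ p q h0 hpq hne
            rw [zero_pow (by omega)]
            simp
        · intro h
          have : X p q = 0 := by
            by_contra hc
            exact h (hXG p q hpq hc)
          simp [this]
      ext p q
      rcases le_total p q with h | h
      · exact hle p q h
      · rw [hX, ← hle q p h]
        simp only [hN, Matrix.of_apply]
        refine sum_congr rfl fun π _ => ?_
        rw [hBsymm, add_comm (b p)]
    have hNrank : ∀ τ, τ ≠ 0 → (N τ).rank ≤ d := by
      intro τ hτ
      have : N τ = Matrix.diagonal (fun p => (τ ^ b p)⁻¹) *
          (∑ π ∈ G, (X π.1 π.2 * τ ^ (b π.1 + b π.2)) • B π) *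
          Matrix.diagonal (fun p => (τ ^ b p)⁻¹) := by
        ext p q
        rw [Matrix.mul_diagonal, Matrix.diagonal_mul, Matrix.sum_apply, mul_sum, sum_mul]
        simp only [hN, Matrix.of_apply]
        refine sum_congr rfl fun π hπ => ?_
        by_cases h0 : B π p q = 0
        · simp [h0]
        · rw [pow_sub₀ _ hτ (hw' π hπ p q h0), Matrix.smul_apply, pow_add τ (b p), mul_inv,
            smul_eq_mul]
          ring
      rw [this]
      refine (Matrix.rank_mul_le_left _ _).trans ((Matrix.rank_mul_le_right _ _).trans
        (hrank _ (W.sum_mem fun π _ => W.smul_mem _ (hBW π))))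
    have hcont : Continuous fun τ => ((N τ).submatrix e₁ e₂).det := by
      apply Continuous.matrix_det
      apply Continuous.matrix_submatrix
      apply continuous_matrix
      intro p q
      simp only [hN, Matrix.of_apply]
      fun_prop
    have hev : ∀ᶠ τ in nhds (0 : ℝ), ((N τ).submatrix e₁ e₂).det ≠ 0 :=
      hcont.continuousAt.eventually_ne (by rw [hNX]; exact hdet)
    obtain ⟨τ, hτ, hτ0⟩ := ((hev.filter_mono nhdsWithin_le_nhds).and
      (self_mem_nhdsWithin (s := {(0 : ℝ)}ᶜ))).exists
    calc Fintype.card ι = ((N τ).submatrix e₁ e₂).rank :=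
          (Matrix.rank_of_isUnit _ ((Matrix.isUnit_iff_isUnit_det _).2 hτ.isUnit)).symm
      _ ≤ (N τ).rank := Matrix.rank_submatrix_le _ _ _
      _ ≤ d := hNrank τ hτ0

theorem exists_row_column_cover {k d : ℕ} (r : Fin k → Fin k → Prop)
    (h : ∀ (S : Finset (Fin k)) (f : Fin k → Fin k), Set.InjOn f S → (∀ x ∈ S, r x (f x)) → #S ≤ d) :
    ∃ R C : Finset (Fin k), #R + #C ≤ d ∧ ∀ x y, r x y → x ∈ R ∨ y ∈ C := by
  classical
  rcases le_or_gt k d with hkd | hkd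
  · exact ⟨univ, ∅, by simpa using hkd, fun x _ _ => Or.inl (mem_univ x)⟩
  set t : Fin k → Finset (Fin k ⊕ Fin (k - (d + 1))) := fun x =>
    (univ.filter fun y => r x y).disjSum univ with ht
  by_cases hall : ∀ X : Finset (Fin k), #X ≤ #(X.biUnion t)
  · exfalso
    obtain ⟨F, hF, hFt⟩ := (all_card_le_biUnion_card_iff_exists_injective t).1 hall
    set S : Finset (Fin k) := univ.filter fun x => (F x).isLeft with hS
    have hcompl : #Sᶜ ≤ k - (d + 1) := by
      have : Sᶜ.image F ⊆ (univ : Finset (Fin (k - (d + 1)))).map ⟨Sum.inr, Sum.inr_injective⟩ := by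
        intro z hz
        obtain ⟨x, hx, rfl⟩ := mem_image.1 hz
        have hx' : ¬ (F x).isLeft := by simpa [hS] using hx
        cases hFx : F x with
        | inl y => simp [hFx] at hx'
        | inr y => simp
      simpa [card_image_of_injective _ hF] using card_le_card this
    have hcard := card_add_card_compl S
    rw [Fintype.card_fin] at hcard
    set f : Fin k → Fin k := fun x => Sum.elim id (fun _ => x) (F x) with hf
    have hfS : ∀ x ∈ S, F x = Sum.inl (f x) := by
      intro x hx
      have hx' : (F x).isLeft := by simpa [hS] using hx
      obtain ⟨y, hy⟩ := Sum.isLeft_iff.1 hx'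
      simp [hf, hy]
    have := h S f (fun x hx y hy hxy => hF (by rw [hfS x hx, hfS y hy, hxy])) (fun x hx => by
      have := hFt x
      rw [hfS x hx] at this
      simpa [ht] using this)
    omega
  · push Not at hall
    obtain ⟨X, hX⟩ := hall
    have hXne : X.Nonempty := by
      rw [nonempty_iff_ne_empty]
      rintro rfl
      simp at hX
    refine ⟨Xᶜ, X.biUnion fun x => univ.filter fun y => r x y, ?_, ?_⟩
    · have hsub : (X.biUnion fun x => univ.filter fun y => r x y).disjSum univ ⊆ X.biUnion t := by
        intro z hz
        rcases z with y | y
        · simpa [ht] using hz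
        · obtain ⟨x, hx⟩ := hXne
          exact mem_biUnion.2 ⟨x, hx, by simp [ht]⟩
      have h1 := card_le_card hsub
      rw [card_disjSum, card_univ, Fintype.card_fin] at h1
      have h2 := card_add_card_compl X
      rw [Fintype.card_fin] at h2
      omega
    · intro x y hxy
      by_cases hx : x ∈ X
      · exact Or.inr (mem_biUnion.2 ⟨x, hx, by simpa using hxy⟩)
      · exact Or.inl (mem_compl.2 hx)

theorem card_le_of_row_column_cover {k d : ℕ} (G : Finset (Fin k × Fin k))
    (hG : ∀ π ∈ G, π.1 ≤ π.2) (R C : Finset (Fin k)) (hRC : #R + #C ≤ d)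
    (h : ∀ π ∈ G, (π.1 ∈ R ∨ π.2 ∈ C) ∧ (π.2 ∈ R ∨ π.1 ∈ C)) :
    ∃ a b : ℕ, a + b ≤ k ∧ 2 * a + b ≤ d ∧
      #G + (k - a + 1).choose 2 ≤ (k + 1).choose 2 + (b + 1).choose 2 := by
  classical
  set A := R ∩ C with hA
  set B := (R ∪ C) \ A with hB
  have hAsub : A ⊆ R ∪ C := inter_subset_left.trans subset_union_left
  have hBA : #B + #A = #(R ∪ C) := card_sdiff_add_card_eq_card hAsub
  have hui : #(R ∪ C) + #A = #R + #C := card_union_add_card_inter R C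
  have hk : #(R ∪ C) ≤ k := by simpa using card_le_univ (R ∪ C)
  refine ⟨#A, #B, by omega, by omega, ?_⟩
  have hinj : Set.InjOn (fun π : Fin k × Fin k => s(π.1, π.2)) G := by
    rintro ⟨p, q⟩ hπ ⟨p', q'⟩ hπ' he
    have h1 : p ≤ q := hG _ hπ
    have h2 : p' ≤ q' := hG _ hπ'
    rcases Sym2.eq_iff.1 he with ⟨rfl, rfl⟩ | ⟨h3, h4⟩
    · rfl
    · dsimp only at h3 h4
      subst h3 h4
      have := le_antisymm h1 h2
      subst this
      rfl
  have hsub : G.image (fun π => s(π.1, π.2)) ⊆ (univ.sym2 \ Aᶜ.sym2) ∪ B.sym2 := by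
    intro z hz
    obtain ⟨⟨p, q⟩, hπ, rfl⟩ := mem_image.1 hz
    have := h _ hπ
    simp only [mem_union, mem_sdiff, mk_mem_sym2_iff, mem_univ, mem_compl, hA, hB, mem_inter] at this ⊢
    tauto
  have h1 := (card_le_card hsub).trans (card_union_le _ _)
  rw [card_image_of_injOn hinj, card_sdiff_of_subset (sym2_mono (subset_univ _)), card_sym2, card_sym2, card_sym2,
    card_compl, card_univ, Fintype.card_fin] at h1
  have h2 : (k - #A + 1).choose 2 ≤ (k + 1).choose 2 := Nat.choose_le_choose 2 (by omega)
  omega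

theorem rank_le_natDegree_det_one_add {k : ℕ} (A : Matrix (Fin k) (Fin k) ℝ) (hA : A.IsSymm) :
    A.rank ≤ (1 + (Polynomial.X : Polynomial ℝ) • A.map Polynomial.C).det.natDegree := by
  classical
  have hH : (-A).IsHermitian := by
    rw [Matrix.IsHermitian, Matrix.conjTranspose_eq_transpose_of_trivial, Matrix.transpose_neg, hA]
  have h1 : (1 + (Polynomial.X : Polynomial ℝ) • A.map Polynomial.C).det = (-A).charpolyRev := by
    rw [Matrix.charpolyRev]
    congr 1
    ext i j
    simp
  have hroot : (-A).charpoly.natTrailingDegree = #(univ.filter fun i => hH.eigenvalues i = 0) := by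
    rw [← Polynomial.rootMultiplicity_eq_natTrailingDegree', ← Polynomial.count_roots,
      hH.roots_charpoly_eq_eigenvalues, Multiset.count_map, Finset.card_def, Finset.filter_val]
    congr 2
    ext i
    simp [eq_comm]
  have hr : A.rank = (-A).rank := by
    rw [← neg_one_smul ℝ A, Matrix.rank_smul_of_mem_nonZeroDivisors]; simp
  rw [h1, ← Matrix.reverse_charpoly, Polynomial.reverse_natDegree, Matrix.charpoly_natDegree_eq_dim,
    hroot, hr, hH.rank_eq_card_non_zero_eigs, Fintype.card_subtype]
  have := card_filter_add_card_filter_not (s := univ) (fun i => hH.eigenvalues i = 0)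
  rw [card_univ] at this
  change #(univ.filter fun i => ¬ hH.eigenvalues i = 0) ≤ _
  omega

theorem rank_sum_smul_le_totalDegree {n k : ℕ} (M : Fin n → Matrix (Fin k) (Fin k) ℝ)
    (hM : ∀ i, (M i).IsSymm) (v : Fin n → ℝ) :
    (∑ i, v i • M i).rank ≤ (pencilR M).det.totalDegree := by
  have hsymm : (∑ i, v i • M i).IsSymm := by
    rw [Matrix.IsSymm, Matrix.transpose_sum]
    exact sum_congr rfl fun i _ => by rw [Matrix.transpose_smul, hM i]
  refine (rank_le_natDegree_det_one_add _ hsymm).trans ?_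
  have h := MvPolynomial.aeval_natDegree_le (n := 1) (pencilR M).det le_rfl
    (fun i => Polynomial.C (v i) * Polynomial.X) fun i => (Polynomial.natDegree_C_mul_le _ _).trans Polynomial.natDegree_X_le
  rw [mul_one] at h
  refine le_of_eq_of_le (congrArg Polynomial.natDegree ?_) h
  rw [AlgHom.map_det]
  congr 1
  ext1 p q
  simp only [pencilR, AlgHom.mapMatrix_apply, Matrix.map_apply, Matrix.add_apply, Matrix.smul_apply,
    Matrix.sum_apply, map_add, map_sum, map_mul, MvPolynomial.aeval_X, smul_eq_mul, mul_sum]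
  congr 1
  · by_cases hpq : p = q <;> simp [Matrix.one_apply, hpq]
  · refine sum_congr rfl fun i _ => ?_
    simp only [← MvPolynomial.algebraMap_eq, AlgHom.commutes, Polynomial.algebraMap_eq]
    ring

/-- Dimension bound for linear spaces of real symmetric matrices of bounded rank. -/
theorem finrank_le_of_rank_le {k d : ℕ} (W : Submodule ℝ (Matrix (Fin k) (Fin k) ℝ))
    (hsymm : ∀ A ∈ W, ∀ p q, A p q = A q p) (hrank : ∀ A ∈ W, A.rank ≤ d) :
    ∃ a b : ℕ, a + b ≤ k ∧ 2 * a + b ≤ d ∧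
      Module.finrank ℝ W + (k - a + 1).choose 2 ≤ (k + 1).choose 2 + (b + 1).choose 2 := by
  obtain ⟨G, hGcard, hG, hGX⟩ := exists_leading_positions W hsymm hrank
  obtain ⟨R, C, hRC, hcov⟩ := exists_row_column_cover (d := d)
    (fun p q => (p, q) ∈ G ∨ (q, p) ∈ G) (by
      intro S f hf hr
      obtain ⟨X, hX, hsupp, hdet⟩ := exists_symm_of_partial_injection S f hf
      have := hGX X hX (by
        intro p q hpq hne
        have hpq' : (p, q) ∈ G ∨ (q, p) ∈ G := by
          rcases hsupp p q hne with ⟨hp, rfl⟩ | ⟨hq, rfl⟩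
          · exact hr p hp
          · exact (hr q hq).symm
        rcases hpq' with h | h
        · exact h
        · have := le_antisymm hpq (hG _ h)
          subst this
          exact h) S _ _ hdet
      simpa using this)
  obtain ⟨a, b, hab, had, hle⟩ := card_le_of_row_column_cover G hG R C hRC
    fun π hπ => ⟨hcov _ _ (Or.inl hπ), hcov _ _ (Or.inr hπ)⟩
  exact ⟨a, b, hab, had, by omega⟩

theorem le_of_quadratic_bound {n k d a b s : ℝ} (ha : 0 ≤ a) (hb : 0 ≤ b) (has : a ≤ s)
    (hd : 2 * a + b ≤ d) (hn : d * (d + 1) / 2 < n)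
    (h : n + (k - a) * (k - a + 1) / 2 ≤ k * (k + 1) / 2 + b * (b + 1) / 2) :
    0 < s ∧ n ≤ s * k - s * (s - 1) / 2 + (d - 2 * s) * (d - 2 * s + 1) / 2 := by
  have hb2 : b * (b + 1) ≤ (d - 2 * a) * (d - 2 * a + 1) := by nlinarith
  have hpos : 0 < a * (3 * a / 2 + (k - 2 * d - 1 / 2)) := by nlinarith
  have ha' : 0 < a := lt_of_le_of_ne ha fun h0 => by simp [← h0] at hpos
  have hc : 0 < 3 * a / 2 + (k - 2 * d - 1 / 2) := (mul_pos_iff_of_pos_left ha').1 hpos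
  refine ⟨ha'.trans_le has, ?_⟩
  have hmono : a * (3 * a / 2 + (k - 2 * d - 1 / 2)) ≤ s * (3 * s / 2 + (k - 2 * d - 1 / 2)) :=
    mul_le_mul has (by linarith) hc.le (ha.trans has)
  nlinarith

/-- Lower bound on the size `k` of a symmetric linear matrix polynomial whose spectrahedron
contains no full line, in terms of the number of variables `n` and the degree `d` of its
determinant, provided `n > d(d+1)/2`. -/
theorem size_lower_bound_symm {n k : ℕ} (M : Fin n → Matrix (Fin k) (Fin k) ℝ)
    (hM : ∀ i, (M i).IsSymm)
    (hline : ¬ ∃ (a v : Fin n → ℝ), v ≠ 0 ∧ ∀ t : ℝ,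
      (1 + ∑ i, (a i + t * v i) • M i).PosSemidef)
    (d : ℕ) (hd : (pencilR M).det.totalDegree = d)
    (hn : d * (d + 1) / 2 < n) :
    (Even d → (k : ℝ) ≥ 2 * n / d + (d - 2) / 4) ∧
    (Odd d → (k : ℝ) ≥ 2 * ((n : ℝ) - 1) / ((d : ℝ) - 1) + ((d : ℝ) - 3) / 4) := by
  have hli : LinearIndependent ℝ M := by
    rw [Fintype.linearIndependent_iff]
    intro v hv
    by_contra! hne
    obtain ⟨i, hi⟩ := hne
    refine hline ⟨0, v, fun h0 => hi (by rw [h0]; rfl), fun t => ?_⟩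
    have : ∑ i, ((0 : Fin n → ℝ) i + t * v i) • M i = 0 := by
      simp only [Pi.zero_apply, zero_add, mul_smul, ← smul_sum, hv, smul_zero]
    rw [this, add_zero]
    exact Matrix.PosSemidef.one
  have hfin : Module.finrank ℝ (Submodule.span ℝ (Set.range M)) = n := by
    rw [finrank_span_eq_card hli, Fintype.card_fin]
  have hmem : ∀ A ∈ Submodule.span ℝ (Set.range M), ∃ v : Fin n → ℝ, ∑ i, v i • M i = A :=
    fun A hA => (Submodule.mem_span_range_iff_exists_fun ℝ).1 hA
  obtain ⟨a, b, hab, had, hle⟩ := finrank_le_of_rank_le (d := d) (Submodule.span ℝ (Set.range M))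
    (by
      intro A hA p q
      obtain ⟨v, rfl⟩ := hmem A hA
      simp only [Matrix.sum_apply, Matrix.smul_apply]
      exact sum_congr rfl fun i _ => by rw [(hM i).apply])
    (by
      intro A hA
      obtain ⟨v, rfl⟩ := hmem A hA
      exact hd ▸ rank_sum_smul_le_totalDegree M hM v)
  rw [hfin] at hle
  have hleR : (n : ℝ) + ((k : ℝ) - a) * ((k : ℝ) - a + 1) / 2 ≤
      (k : ℝ) * (k + 1) / 2 + (b : ℝ) * (b + 1) / 2 := by
    have h : (n : ℝ) + ((k - a + 1).choose 2 : ℕ) ≤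
        (((k + 1).choose 2 : ℕ) : ℝ) + ((b + 1).choose 2 : ℕ) := by exact_mod_cast hle
    rw [Nat.cast_choose_two, Nat.cast_choose_two, Nat.cast_choose_two] at h
    push_cast [Nat.cast_sub (show a ≤ k by omega)] at h
    linarith
  have hnR : (d : ℝ) * (d + 1) / 2 < n := by
    have h : d * (d + 1) < 2 * n := by
      have := Nat.div_mul_cancel (Nat.even_mul_succ_self d).two_dvd
      omega
    have : (d : ℝ) * (d + 1) < 2 * n := by exact_mod_cast h
    linarith
  have hadR : 2 * (a : ℝ) + b ≤ d := by exact_mod_cast had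
  constructor
  · rintro ⟨s, rfl⟩
    have has : (a : ℝ) ≤ s := by exact_mod_cast (show a ≤ s by omega)
    obtain ⟨hs, hb⟩ := le_of_quadratic_bound a.cast_nonneg b.cast_nonneg has hadR hnR hleR
    push_cast at hb ⊢
    rw [ge_iff_le, ← le_sub_iff_add_le, div_le_iff₀ (by linarith)]
    nlinarith
  · rintro ⟨s, rfl⟩
    have has : (a : ℝ) ≤ s := by exact_mod_cast (show a ≤ s by omega)
    obtain ⟨hs, hb⟩ := le_of_quadratic_bound a.cast_nonneg b.cast_nonneg has hadR hnR hleR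
    push_cast at hb ⊢
    rw [ge_iff_le, ← le_sub_iff_add_le, div_le_iff₀ (by linarith)]
    nlinarith
end

section
/- Let p ∈ ℝ[x₁,…,xₙ] be a real zero polynomial of degree d whose rigidly convex set S(p) contains a full-dimensional cone (there is a nonempty open set U ⊆ ℝⁿ with t·a ∈ S(p) for all a ∈ U, t ≥ 0) but does not contain a full line (there are no a, v ∈ ℝⁿ with v ≠ 0 and a + t·v ∈ S(p) for all t ∈ ℝ). If n > d(d+1)/2, then p has no symmetric determinantal representation of any size. If n > d², then p has no hermitian determinantal representation of any size. -/
open MvPolynomial Matrix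

/-- The rigidly convex set `S(p) = {a : p(t·a) ≠ 0 for all t ∈ [0,1)}`. -/
def Srz {n : ℕ} (p : MvPolynomial (Fin n) ℝ) : Set (Fin n → ℝ) :=
  {a | ∀ t ∈ Set.Ico (0 : ℝ) 1, MvPolynomial.eval (t • a) p ≠ 0}

section HermitianFamilies

open scoped ComplexOrder

variable {𝕜 : Type*} [RCLike 𝕜] {κ : Type*} [Fintype κ]

/-- If a linear family of matrices is positive semidefinite near `e`, then the kernel of its value
at `e` is contained in the kernel of each of its values. -/
theorem mulVec_eq_zero_of_posSemidef_of_mem_open {E : Type*} [NormedAddCommGroup E]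
    [NormedSpace ℝ E] (A : E →ₗ[ℝ] Matrix κ κ 𝕜) {U : Set E} (hU : IsOpen U)
    (hpsd : ∀ a ∈ U, (A a).PosSemidef) {e : E} (he : e ∈ U) {w : κ → 𝕜} (hw : A e *ᵥ w = 0)
    (v : E) : A v *ᵥ w = 0 := by
  have hnhds : ∀ᶠ s : ℝ in nhds 0, e + s • v ∈ U ∧ e - s • v ∈ U := by
    refine Filter.Eventually.and ?_ ?_
    · exact ContinuousAt.eventually_mem (f := fun s : ℝ => e + s • v) (by fun_prop)
        (by simpa using hU.mem_nhds he)
    · exact ContinuousAt.eventually_mem (f := fun s : ℝ => e - s • v) (by fun_prop)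
        (by simpa using hU.mem_nhds he)
  obtain ⟨s, ⟨hplus, hminus⟩, hs⟩ :=
    ((hnhds.filter_mono nhdsWithin_le_nhds).and self_mem_nhdsWithin :
      ∀ᶠ s : ℝ in nhdsWithin 0 (Set.Ioi 0), _).exists
  have hs0 : (s : ℝ) ≠ 0 := ne_of_gt hs
  have expand_add : A (e + s • v) *ᵥ w = s • (A v *ᵥ w) := by
    rw [map_add, map_smul, add_mulVec, hw, zero_add, smul_mulVec]
  have expand_sub : A (e - s • v) *ᵥ w = -(s • (A v *ᵥ w)) := by
    rw [map_sub, map_smul, sub_mulVec, hw, zero_sub, smul_mulVec]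
  have h1 := (hpsd _ hplus).dotProduct_mulVec_nonneg w
  have h2 := (hpsd _ hminus).dotProduct_mulVec_nonneg w
  rw [expand_sub, dotProduct_neg, ← expand_add, Left.nonneg_neg_iff] at h2
  have h3 := ((hpsd _ hplus).dotProduct_mulVec_zero_iff w).1 (le_antisymm h2 h1)
  rw [expand_add] at h3
  exact (smul_eq_zero.1 h3).resolve_left hs0

variable [DecidableEq κ]

theorem Matrix.IsHermitian.det_one_add_smul {A : Matrix κ κ 𝕜} (hA : A.IsHermitian) (t : ℝ) :
    (1 + t • A).det = ((∏ i, (1 + t * hA.eigenvalues i) : ℝ) : 𝕜) := by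
  set V : Matrix κ κ 𝕜 := (hA.eigenvectorUnitary : Matrix κ κ 𝕜) with hV
  have hVV : V * star V = 1 := Unitary.coe_mul_star_self hA.eigenvectorUnitary
  have hspec : A = V * diagonal (RCLike.ofReal ∘ hA.eigenvalues) * star V := by
    conv_lhs => rw [hA.spectral_theorem]
    rw [Unitary.conjStarAlgAut_apply]
  have hdiag : (1 + t • A) =
      V * diagonal (fun i => ((1 + t * hA.eigenvalues i : ℝ) : 𝕜)) * star V := by
    have : diagonal (fun i => ((1 + t * hA.eigenvalues i : ℝ) : 𝕜)) =
        (1 : Matrix κ κ 𝕜) + t • diagonal (RCLike.ofReal ∘ hA.eigenvalues) := by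
      ext i j
      by_cases h : i = j
      · subst h
        simp [RCLike.real_smul_eq_coe_mul]
      · simp [h]
    rw [this, mul_add, add_mul, mul_one, hVV, mul_smul_comm, smul_mul_assoc, ← hspec]
  rw [hdiag, det_mul_right_comm, hVV, one_mul, det_diagonal]
  push_cast
  rfl

theorem Matrix.IsHermitian.posSemidef_of_det_one_add_smul_ne_zero {A : Matrix κ κ 𝕜}
    (hA : A.IsHermitian) (h : ∀ t : ℝ, 0 ≤ t → (1 + t • A).det ≠ 0) : A.PosSemidef := by
  rw [hA.posSemidef_iff_eigenvalues_nonneg]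
  intro i
  by_contra! hi
  simp only [Pi.zero_apply] at hi
  refine h (-(hA.eigenvalues i)⁻¹) (by simpa using hi.le) ?_
  rw [hA.det_one_add_smul, RCLike.ofReal_eq_zero]
  refine Finset.prod_eq_zero (Finset.mem_univ i) ?_
  field_simp [hi.ne]
  ring

/-- The number of nonzero eigenvalues of `A` is bounded by the degree of any polynomial agreeing
with `t ↦ det (1 + t A)`. -/
theorem Matrix.IsHermitian.card_eigenvalues_ne_zero_le {A : Matrix κ κ 𝕜} (hA : A.IsHermitian)
    {q : Polynomial ℝ} (hq : ∀ t : ℝ, ((q.eval t : ℝ) : 𝕜) = (1 + t • A).det) :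
    Fintype.card {i // hA.eigenvalues i ≠ 0} ≤ q.natDegree := by
  have hprod : q = ∏ i, (Polynomial.C (hA.eigenvalues i) * Polynomial.X + Polynomial.C 1) := by
    refine Polynomial.funext fun t => ?_
    have h := hq t
    rw [hA.det_one_add_smul] at h
    rw [RCLike.ofReal_injective h, Polynomial.eval_prod]
    refine Finset.prod_congr rfl fun i _ => ?_
    simp
    ring
  rw [hprod, Polynomial.natDegree_prod]
  · rw [Fintype.card_subtype, Finset.card_filter]
    refine Finset.sum_le_sum fun i _ => ?_
    split_ifs with h
    · rw [Polynomial.natDegree_linear h]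
    · exact Nat.zero_le _
  · intro i _ h0
    have := congrArg (Polynomial.eval 0) h0
    simp at this

/-- A linear family of hermitian matrices that is positive semidefinite on a nonempty open set can
be compressed, without enlarging its kernel, to hermitian matrices whose size is the number of
nonzero eigenvalues of its value at a point of that set. -/
theorem exists_compression_of_posSemidef {E : Type*} [NormedAddCommGroup E]
    [NormedSpace ℝ E] (A : E →ₗ[ℝ] Matrix κ κ 𝕜) (hA : ∀ v, (A v).IsHermitian)
    {U : Set E} (hU : IsOpen U) (hpsd : ∀ a ∈ U, (A a).PosSemidef) {e : E} (he : e ∈ U) :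
    ∃ B : E →ₗ[ℝ] Matrix {i // (hA e).eigenvalues i ≠ 0} {i // (hA e).eigenvalues i ≠ 0} 𝕜,
      (∀ v, (B v).IsHermitian) ∧ ∀ v, B v = 0 → A v = 0 := by
  set V : Matrix κ κ 𝕜 := ((hA e).eigenvectorUnitary : Matrix κ κ 𝕜) with hV
  have hVV : V * star V = 1 := Unitary.coe_mul_star_self (hA e).eigenvectorUnitary
  have hherm : ∀ v, (star V * A v * V).IsHermitian := fun v =>
    isHermitian_conjTranspose_mul_mul V (hA v)
  refine ⟨{ toFun := fun v => (star V * A v * V).submatrix Subtype.val Subtype.val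
            map_add' := fun v w => by
              simp only [map_add, mul_add, add_mul, submatrix_add]
              rfl
            map_smul' := fun c v => by
              simp only [map_smul, mul_smul_comm, smul_mul_assoc, submatrix_smul]
              rfl },
    fun v => (hherm v).submatrix _, fun v hv => ?_⟩
  have hcol : ∀ i j, (hA e).eigenvalues j = 0 → (star V * A v * V) i j = 0 := by
    intro i j hj
    have h0 : A v *ᵥ ⇑((hA e).eigenvectorBasis j) = 0 := by
      refine mulVec_eq_zero_of_posSemidef_of_mem_open A hU hpsd he ?_ v
      rw [(hA e).mulVec_eigenvectorBasis, hj, zero_smul]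
    have : (star V * A v * V) *ᵥ Pi.single j 1 = 0 := by
      rw [← mulVec_mulVec, hV, (hA e).eigenvectorUnitary_mulVec, ← mulVec_mulVec, h0, mulVec_zero]
    simpa using congrFun this i
  have hzero : star V * A v * V = 0 := by
    ext i j
    by_cases hj : (hA e).eigenvalues j = 0
    · exact hcol i j hj
    by_cases hi : (hA e).eigenvalues i = 0
    · rw [← (hherm v).apply, hcol j i hi, star_zero, Matrix.zero_apply]
    · exact congrFun (congrFun hv ⟨i, hi⟩) ⟨j, hj⟩
  calc A v = V * (star V * A v * V) * star V := by
        rw [← mul_assoc, ← mul_assoc, hVV, one_mul, mul_assoc, hVV, mul_one]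
    _ = 0 := by rw [hzero, mul_zero, zero_mul]

end HermitianFamilies

theorem exists_ne_zero_map_eq_zero_of_symm {E ι : Type*} [AddCommGroup E] [Module ℝ E]
    [FiniteDimensional ℝ E] [Fintype ι] (B : E →ₗ[ℝ] Matrix ι ι ℝ)
    (hB : ∀ v, (B v).IsHermitian)
    (hdim : Fintype.card ι * (Fintype.card ι + 1) / 2 < Module.finrank ℝ E) :
    ∃ v ≠ 0, B v = 0 := by
  classical
  let L : E →ₗ[ℝ] (Sym2 ι → ℝ) :=
    { toFun := fun v => Sym2.lift ⟨fun i j => B v i j, fun i j => ((hB v).apply i j).symm⟩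
      map_add' := fun v w => by
        ext z
        induction z with | h i j => simp
      map_smul' := fun c v => by
        ext z
        induction z with | h i j => simp }
  have hker : LinearMap.ker L ≠ ⊥ := by
    refine LinearMap.ker_ne_bot_of_finrank_lt ?_
    rw [Module.finrank_fintype_fun_eq_card, Sym2.card, Nat.choose_two_right, Nat.add_sub_cancel,
      mul_comm]
    exact hdim
  obtain ⟨v, hv, hv0⟩ := Submodule.exists_mem_ne_zero_of_ne_bot hker
  refine ⟨v, hv0, ?_⟩
  ext i j
  simpa [L] using congrFun hv s(i, j)

theorem exists_ne_zero_map_eq_zero_of_isHermitian {E ι : Type*} [AddCommGroup E] [Module ℝ E]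
    [FiniteDimensional ℝ E] [Fintype ι] (B : E →ₗ[ℝ] Matrix ι ι ℂ)
    (hB : ∀ v, (B v).IsHermitian) (hdim : Fintype.card ι ^ 2 < Module.finrank ℝ E) :
    ∃ v ≠ 0, B v = 0 := by
  let L : E →ₗ[ℝ] (ι × ι → ℝ) :=
    { toFun := fun v z => (B v z.1 z.2).re + (B v z.1 z.2).im
      map_add' := fun v w => by
        ext z
        simp
        ring
      map_smul' := fun c v => by
        ext z
        simp
        ring }
  have hker : LinearMap.ker L ≠ ⊥ := by
    refine LinearMap.ker_ne_bot_of_finrank_lt ?_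
    rwa [Module.finrank_fintype_fun_eq_card, Fintype.card_prod, ← sq]
  obtain ⟨v, hv, hv0⟩ := Submodule.exists_mem_ne_zero_of_ne_bot hker
  refine ⟨v, hv0, ?_⟩
  ext i j
  have h1 : (B v i j).re + (B v i j).im = 0 := congrFun hv (i, j)
  have h2 : (B v j i).re + (B v j i).im = 0 := congrFun hv (j, i)
  rw [← (hB v).apply] at h2
  simp only [RCLike.star_def, Complex.conj_re, Complex.conj_im] at h2
  apply Complex.ext
  · simp only [Matrix.zero_apply, Complex.zero_re]
    linarith
  · simp only [Matrix.zero_apply, Complex.zero_im]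
    linarith

/-- The real linear family `v ↦ v₁M₁ + ⋯ + vₙMₙ`. -/
noncomputable def linearFamily {𝕜 : Type*} [RCLike 𝕜] {n k : ℕ}
    (M : Fin n → Matrix (Fin k) (Fin k) 𝕜) : (Fin n → ℝ) →ₗ[ℝ] Matrix (Fin k) (Fin k) 𝕜 :=
  Fintype.linearCombination ℝ M

theorem isHermitian_linearFamily {𝕜 : Type*} [RCLike 𝕜] {n k : ℕ}
    {M : Fin n → Matrix (Fin k) (Fin k) 𝕜} (hM : ∀ i, (M i).IsHermitian) (v : Fin n → ℝ) :
    (linearFamily M v).IsHermitian := by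
  simp only [linearFamily, Fintype.linearCombination_apply, IsHermitian, conjTranspose_sum,
    conjTranspose_smul, (hM _).eq, star_trivial]

theorem eval_det_pencil {n k : ℕ} (M : Fin n → Matrix (Fin k) (Fin k) ℂ) (v : Fin n → ℝ) :
    MvPolynomial.eval (fun i => (v i : ℂ)) (pencil M).det = (1 + linearFamily M v).det := by
  rw [RingHom.map_det]
  congr 1
  ext i j
  simp [pencil, linearFamily, Fintype.linearCombination_apply, Matrix.sum_apply, Matrix.one_apply,
    apply_ite, mul_comm]

theorem eval_det_pencilR {n k : ℕ} (M : Fin n → Matrix (Fin k) (Fin k) ℝ) (v : Fin n → ℝ) :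
    MvPolynomial.eval v (pencilR M).det = (1 + linearFamily M v).det := by
  rw [RingHom.map_det]
  congr 1
  ext i j
  simp [pencilR, linearFamily, Fintype.linearCombination_apply, Matrix.sum_apply, Matrix.one_apply,
    apply_ite, mul_comm]

open scoped ComplexOrder in
/-- A representation of `p` as the determinant of a hermitian family can be compressed to a family
of size at most the degree of `p` which vanishes nowhere but at the origin. -/
theorem exists_compression_of_det_eq {𝕜 : Type*} [RCLike 𝕜] {n k : ℕ}
    {p : MvPolynomial (Fin n) ℝ} {U : Set (Fin n → ℝ)} (hUopen : IsOpen U) (hUne : U.Nonempty)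
    (hcone : ∀ a ∈ U, ∀ t : ℝ, 0 ≤ t → t • a ∈ Srz p)
    (hline : ¬ ∃ (a v : Fin n → ℝ), v ≠ 0 ∧ ∀ t : ℝ, a + t • v ∈ Srz p)
    (A : (Fin n → ℝ) →ₗ[ℝ] Matrix (Fin k) (Fin k) 𝕜) (hA : ∀ v, (A v).IsHermitian)
    (hdet : ∀ v, ((MvPolynomial.eval v p : ℝ) : 𝕜) = (1 + A v).det) :
    ∃ (ι : Type) (_ : Fintype ι) (B : (Fin n → ℝ) →ₗ[ℝ] Matrix ι ι 𝕜),
      Fintype.card ι ≤ p.totalDegree ∧ (∀ v, (B v).IsHermitian) ∧ ∀ v, B v = 0 → v = 0 := by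
  obtain ⟨e, he⟩ := hUne
  have hpsd : ∀ a ∈ U, (A a).PosSemidef := by
    refine fun a ha => (hA a).posSemidef_of_det_one_add_smul_ne_zero fun t ht => ?_
    rw [← map_smul, ← hdet, RCLike.ofReal_ne_zero]
    have := hcone a ha (2 * t) (by positivity) (1 / 2) (by norm_num)
    rwa [smul_smul, show (1 / 2 : ℝ) * (2 * t) = t by ring] at this
  obtain ⟨B, hB, hBA⟩ := exists_compression_of_posSemidef A hA hUopen hpsd he
  refine ⟨_, inferInstance, B, ?_, hB, fun v hv => ?_⟩
  · let q : Polynomial ℝ :=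
      MvPolynomial.aeval (fun i => Polynomial.C (e i) * Polynomial.X) p
    have hq : ∀ t : ℝ, q.eval t = MvPolynomial.eval (t • e) p := by
      intro t
      simp only [q]
      rw [← Polynomial.coe_evalRingHom, MvPolynomial.aeval_def, MvPolynomial.hom_eval₂,
        MvPolynomial.eval, MvPolynomial.coe_eval₂Hom]
      congr 1
      · ext x
        exact Polynomial.eval_C
      · ext i
        simp only [Polynomial.coe_evalRingHom, Polynomial.eval_mul,
          Polynomial.eval_C, Polynomial.eval_X, Pi.smul_apply, smul_eq_mul]
        ring
    refine ((hA e).card_eigenvalues_ne_zero_le (q := q) fun t => ?_).trans ?_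
    · rw [hq, hdet, map_smul]
    · simpa using MvPolynomial.aeval_natDegree_le p le_rfl
        (fun i => Polynomial.C (e i) * Polynomial.X)
        (fun i => (Polynomial.natDegree_C_mul_le _ _).trans Polynomial.natDegree_X_le)
  · by_contra hv0
    refine hline ⟨0, v, hv0, fun t s _ => ?_⟩
    rw [← RCLike.ofReal_ne_zero (K := 𝕜), hdet]
    simp [hBA v hv]

/-- A real zero polynomial of degree `d` whose rigidly convex set contains a full-dimensional
cone but no full line has no symmetric determinantal representation if `n > d(d+1)/2`, and no
hermitian determinantal representation if `n > d²`. -/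
theorem no_rep_of_many_vars {n : ℕ} (p : MvPolynomial (Fin n) ℝ) (hrz : IsRZ p)
    (d : ℕ) (hd : p.totalDegree = d)
    (U : Set (Fin n → ℝ)) (hUopen : IsOpen U) (hUne : U.Nonempty)
    (hcone : ∀ a ∈ U, ∀ t : ℝ, 0 ≤ t → t • a ∈ Srz p)
    (hline : ¬ ∃ (a v : Fin n → ℝ), v ≠ 0 ∧ ∀ t : ℝ, a + t • v ∈ Srz p) :
    (d * (d + 1) / 2 < n → ∀ k, ¬ HasSymmRep p k) ∧
    (d ^ 2 < n → ∀ k, ¬ HasHermRep p k) := by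
  subst hd
  refine ⟨?_, ?_⟩
  · rintro hn k ⟨M, hM, hp⟩
    have hdet : ∀ v, ((MvPolynomial.eval v p : ℝ) : ℝ) = (1 + linearFamily M v).det := fun v => by
      rw [← eval_det_pencilR, ← hp]
    obtain ⟨ι, _, B, hcard, hB, hB0⟩ := exists_compression_of_det_eq hUopen hUne hcone hline
      (linearFamily M) (isHermitian_linearFamily fun i => hM i) hdet
    obtain ⟨v, hv, hBv⟩ := exists_ne_zero_map_eq_zero_of_symm B hB (by
      rw [Module.finrank_fin_fun]
      exact lt_of_le_of_lt (by gcongr) hn)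
    exact hv (hB0 v hBv)
  · rintro hn k ⟨M, hM, hp⟩
    have hdet : ∀ v, ((MvPolynomial.eval v p : ℝ) : ℂ) = (1 + linearFamily M v).det := fun v => by
      rw [← eval_det_pencil, ← hp, MvPolynomial.eval_map]
      exact MvPolynomial.eval₂_comp (algebraMap ℝ ℂ) v p
    obtain ⟨ι, _, B, hcard, hB, hB0⟩ := exists_compression_of_det_eq hUopen hUne hcone hline
      (linearFamily M) (isHermitian_linearFamily hM) hdet
    obtain ⟨v, hv, hBv⟩ := exists_ne_zero_map_eq_zero_of_isHermitian B hB (by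
      rw [Module.finrank_fin_fun]
      exact lt_of_le_of_lt (by gcongr) hn)
    exact hv (hB0 v hBv)
end

section
/- Let p ∈ ℝ[x₁,…,xₙ] be a real zero polynomial of degree d ≥ 1, and write p = q₀ + q₁ + ⋯ + q_d where qⱼ is the homogeneous part of p of degree j (so q₀ = 1). Suppose p^r = det(I + x₁M₁ + ⋯ + xₙMₙ) for complex hermitian matrices M₁,…,Mₙ of size r·d. Then for every a ∈ ℝⁿ, writing A = a₁M₁ + ⋯ + aₙMₙ, one has Σ_{j=0}^{d} qⱼ(a)·(−A)^{d−j} = 0 (the zero matrix); that is, the homogenization p̂ of p vanishes at (x₀, x₁,…,xₙ) = (−A, a₁,…,aₙ). -/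
open MvPolynomial Matrix

open scoped ComplexOrder in
theorem Matrix.IsHermitian.eq_zero_of_isNilpotent {m : Type*} [Fintype m] [DecidableEq m]
    {B : Matrix m m ℂ} (hB : B.IsHermitian) (hnil : IsNilpotent B) : B = 0 := by
  obtain ⟨k, hk⟩ := hnil
  have key : ∀ l : ℕ, B ^ (2 ^ l) = 0 → B = 0 := by
    intro l
    induction l with
    | zero => simp
    | succ l ih =>
      intro h
      apply ih
      rw [← Matrix.conjTranspose_mul_self_eq_zero, (hB.pow (2 ^ l)).eq, ← pow_add, ← h]
      congr 1
      ring
  exact key k (pow_eq_zero_of_le Nat.lt_two_pow_self.le hk)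

theorem MvPolynomial.IsHomogeneous.eval₂_mul {σ R S : Type*} [CommSemiring R] [CommSemiring S]
    {φ : MvPolynomial σ R} {j : ℕ} (hφ : φ.IsHomogeneous j) (f : R →+* S) (c : S) (g : σ → S) :
    MvPolynomial.eval₂ f (fun i => c * g i) φ = c ^ j * MvPolynomial.eval₂ f g φ := by
  simp only [MvPolynomial.eval₂_eq, Finset.mul_sum, mul_pow, Finset.prod_mul_distrib]
  refine Finset.sum_congr rfl fun s hs => ?_
  have hdeg : s.degree = j := by
    rw [Finsupp.degree_eq_weight_one]
    exact hφ (MvPolynomial.mem_support_iff.mp hs)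
  rw [Finset.prod_pow_eq_pow_sum, ← hdeg, Finsupp.degree_apply]
  ring

theorem det_pencil_eval {n k : ℕ} (M : Fin n → Matrix (Fin k) (Fin k) ℂ) (v : Fin n → ℂ) :
    MvPolynomial.eval v (pencil M).det = (1 + ∑ i, v i • M i).det := by
  rw [RingHom.map_det]
  congr 1
  ext s t
  simp [pencil, Matrix.sum_apply, Matrix.one_apply, apply_ite, mul_comm]

/-- The homogenization `t ^ d * p (a / t)`, for `a` fixed, as a univariate polynomial in `t`. -/
noncomputable def rayHomogenization {σ : Type*} (p : MvPolynomial σ ℝ) (d : ℕ) (a : σ → ℝ) :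
    Polynomial ℝ :=
  ∑ j ∈ Finset.range (d + 1),
    Polynomial.C (MvPolynomial.eval a (MvPolynomial.homogeneousComponent j p)) *
      Polynomial.X ^ (d - j)

theorem eval_rayHomogenization {σ : Type*} (p : MvPolynomial σ ℝ) (a : σ → ℝ) {z : ℂ}
    (hz : z ≠ 0) :
    ((rayHomogenization p p.totalDegree a).map (algebraMap ℝ ℂ)).eval z =
      z ^ p.totalDegree *
        MvPolynomial.eval (fun i => z⁻¹ * (a i : ℂ)) (MvPolynomial.map (algebraMap ℝ ℂ) p) := by
  conv_rhs => enter [2, 2]; rw [← MvPolynomial.sum_homogeneousComponent p]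
  simp only [rayHomogenization, Polynomial.map_sum, Polynomial.eval_finsetSum, map_sum,
    Finset.mul_sum]
  refine Finset.sum_congr rfl fun j hj => ?_
  have hj' : j ≤ p.totalDegree := Nat.lt_succ_iff.mp (Finset.mem_range.mp hj)
  rw [MvPolynomial.eval_map,
    (MvPolynomial.homogeneousComponent_isHomogeneous j p).eval₂_mul (algebraMap ℝ ℂ)]
  have h : MvPolynomial.eval₂ (algebraMap ℝ ℂ) (fun i => (a i : ℂ))
      (MvPolynomial.homogeneousComponent j p) =
      algebraMap ℝ ℂ (MvPolynomial.eval a (MvPolynomial.homogeneousComponent j p)) :=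
    (MvPolynomial.eval₂_comp_left (algebraMap ℝ ℂ) (RingHom.id ℝ) a _).symm
  rw [h, inv_pow, ← mul_assoc, ← pow_sub₀ z hz hj', Polynomial.map_mul, Polynomial.map_C,
    Polynomial.map_pow, Polynomial.map_X, Polynomial.eval_C_mul, Polynomial.eval_pow,
    Polynomial.eval_X, mul_comm]

theorem charpoly_neg_eq_rayHomogenization_pow {n : ℕ} (p : MvPolynomial (Fin n) ℝ) {r : ℕ}
    (M : Fin n → Matrix (Fin (r * p.totalDegree)) (Fin (r * p.totalDegree)) ℂ)
    (hrep : MvPolynomial.map (algebraMap ℝ ℂ) (p ^ r) = (pencil M).det) (a : Fin n → ℝ) :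
    (-(∑ i, (a i : ℂ) • M i)).charpoly =
      (rayHomogenization p p.totalDegree a).map (algebraMap ℝ ℂ) ^ r := by
  apply Polynomial.eq_of_infinite_eval_eq
  refine (Set.finite_singleton (0 : ℂ)).infinite_compl.mono fun z hz => ?_
  have hz : z ≠ 0 := hz
  have hdet := det_pencil_eval M (fun i => z⁻¹ * (a i : ℂ))
  rw [← hrep, map_pow, map_pow] at hdet
  have hscale : Matrix.scalar (Fin (r * p.totalDegree)) z - -(∑ i, (a i : ℂ) • M i) =
      z • (1 + ∑ i, (z⁻¹ * (a i : ℂ)) • M i) := by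
    simp only [smul_add, Finset.smul_sum, smul_smul, mul_inv_cancel_left₀ hz, sub_neg_eq_add,
      Matrix.smul_one_eq_diagonal, Matrix.scalar_apply]
  rw [Set.mem_ofPred_eq]
  rw [Matrix.eval_charpoly, hscale, Matrix.det_smul, ← hdet, Polynomial.eval_pow,
    eval_rayHomogenization p a hz, mul_pow, ← pow_mul, Fintype.card_fin, mul_comm r]

/-- If `p` is a real zero polynomial of degree `d ≥ 1` with homogeneous parts `qⱼ`, and
`p^r = det(I + x₁M₁ + ⋯ + xₙMₙ)` for hermitian matrices of size `r·d`, then for every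
`a ∈ ℝⁿ` with `A = a₁M₁ + ⋯ + aₙMₙ` one has `∑ⱼ qⱼ(a)·(−A)^{d−j} = 0`; that is, the
homogenization `p̂` of `p` vanishes at `(−A, a₁,…,aₙ)`. -/
theorem pencil_satisfies_homogenization {n : ℕ} (p : MvPolynomial (Fin n) ℝ)
    (hrz : IsRZ p) (d : ℕ) (hd1 : 1 ≤ d) (hd : p.totalDegree = d) (r : ℕ)
    (M : Fin n → Matrix (Fin (r * d)) (Fin (r * d)) ℂ) (hM : ∀ i, (M i).IsHermitian)
    (hrep : MvPolynomial.map (algebraMap ℝ ℂ) (p ^ r) = (pencil M).det)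
    (a : Fin n → ℝ) :
    ∑ j ∈ Finset.range (d + 1),
      ((MvPolynomial.eval a (MvPolynomial.homogeneousComponent j p) : ℝ) : ℂ) •
        (-(∑ i, (a i : ℂ) • M i)) ^ (d - j) = 0 := by
  subst hd
  set N := -(∑ i, (a i : ℂ) • M i) with hN
  have hNherm : N.IsHermitian := by
    simp [hN, Matrix.IsHermitian, Matrix.conjTranspose_sum, (hM _).eq]
  have hsum : ∑ j ∈ Finset.range (p.totalDegree + 1),
      ((MvPolynomial.eval a (MvPolynomial.homogeneousComponent j p) : ℝ) : ℂ) •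
        N ^ (p.totalDegree - j) =
      Polynomial.aeval N ((rayHomogenization p p.totalDegree a).map (algebraMap ℝ ℂ)) := by
    simp [rayHomogenization, Polynomial.map_sum, ← Algebra.smul_def]
  refine Matrix.IsHermitian.eq_zero_of_isNilpotent ?_ ⟨r, ?_⟩
  · simp only [Matrix.IsHermitian, Matrix.conjTranspose_sum, Matrix.conjTranspose_smul,
      Matrix.conjTranspose_pow, hNherm.eq, RCLike.star_def, Complex.conj_ofReal]
  · rw [hsum, ← map_pow, ← charpoly_neg_eq_rayHomogenization_pow p M hrep a]
    exact Matrix.aeval_self_charpoly N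
end

section
/- Let p ∈ ℝ[x₁,…,xₙ] be an irreducible real zero polynomial of degree d ≥ 1, and write p = q₀ + q₁ + ⋯ + q_d where qⱼ is the homogeneous part of p of degree j (so q₀ = 1). Suppose M₁,…,Mₙ are complex hermitian k×k matrices such that for every a ∈ ℝⁿ, writing A = a₁M₁ + ⋯ + aₙMₙ, one has Σ_{j=0}^{d} qⱼ(a)·(−A)^{d−j} = 0. Then d divides k, and for r = k/d one has det(I + x₁M₁ + ⋯ + xₙMₙ) = p^r. -/
open MvPolynomial Matrix

/-- A complex polynomial fixed by conjugating its coefficients comes from a real one. -/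
lemma exists_map_ofReal_eq_of_map_conj_eq {σ : Type*} {f : MvPolynomial σ ℂ}
    (hf : MvPolynomial.map (starRingEnd ℂ) f = f) :
    ∃ g : MvPolynomial σ ℝ, MvPolynomial.map (algebraMap ℝ ℂ) g = f := by
  refine MvPolynomial.mem_range_map_iff_coeffs_subset.2 fun c hc => ?_
  obtain ⟨m, -, rfl⟩ := MvPolynomial.mem_coeffs_iff.1 hc
  have h := congrArg (MvPolynomial.coeff m) hf
  rw [MvPolynomial.coeff_map] at h
  obtain ⟨r, hr⟩ := Complex.conj_eq_iff_real.1 h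
  exact ⟨r, hr.symm⟩

/-- A matrix of complex polynomials whose entrywise conjugate is its transpose has a real
determinant. -/
lemma exists_map_ofReal_eq_det {σ ι : Type*} [Fintype ι] [DecidableEq ι]
    {A : Matrix ι ι (MvPolynomial σ ℂ)}
    (hA : (MvPolynomial.map (starRingEnd ℂ)).mapMatrix A = Aᵀ) :
    ∃ g : MvPolynomial σ ℝ, MvPolynomial.map (algebraMap ℝ ℂ) g = A.det := by
  apply exists_map_ofReal_eq_of_map_conj_eq
  rw [RingHom.map_det, hA, Matrix.det_transpose]

/-- Two complex polynomials agreeing at all real points are equal. -/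
lemma eq_of_eval_ofReal_eq {n : ℕ} {f g : MvPolynomial (Fin n) ℂ}
    (h : ∀ a : Fin n → ℝ, MvPolynomial.eval (fun i => (a i : ℂ)) f =
      MvPolynomial.eval (fun i => (a i : ℂ)) g) : f = g := by
  refine MvPolynomial.funext_set (fun _ => Set.range ((↑) : ℝ → ℂ))
    (fun _ => Set.infinite_range_of_injective Complex.ofReal_injective) fun x hx => ?_
  choose a ha using fun i => hx i (Set.mem_univ i)
  simpa [ha] using h a

lemma homogeneousComponent_totalDegree_ne_zero {σ R : Type*} [CommSemiring R]
    {p : MvPolynomial σ R} (hp : p ≠ 0) :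
    MvPolynomial.homogeneousComponent p.totalDegree p ≠ 0 := by
  obtain ⟨m, hm, hmax⟩ := Finset.exists_mem_eq_sup p.support
    (MvPolynomial.support_nonempty.2 hp) (fun s => s.sum fun _ e => e)
  intro h
  have h' := congrArg (MvPolynomial.coeff m) h
  rw [MvPolynomial.coeff_homogeneousComponent, if_pos] at h'
  · exact MvPolynomial.mem_support_iff.1 hm h'
  · exact hmax.symm

/-- Restriction of a polynomial to the line through the origin spanned by `a`. -/
noncomputable def lineRestriction {n : ℕ} {R : Type*} [CommRing R] (a : Fin n → R) :
    MvPolynomial (Fin n) R →+* Polynomial R :=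
  MvPolynomial.eval₂Hom Polynomial.C fun i => Polynomial.X * Polynomial.C (a i)

lemma lineRestriction_of_isHomogeneous {n : ℕ} {R : Type*} [CommRing R] (a : Fin n → R)
    {q : MvPolynomial (Fin n) R} {j : ℕ} (hq : q.IsHomogeneous j) :
    lineRestriction a q = Polynomial.monomial j (MvPolynomial.eval a q) := by
  rw [lineRestriction, MvPolynomial.coe_eval₂Hom, MvPolynomial.eval₂_eq', MvPolynomial.eval_eq',
    map_sum]
  refine Finset.sum_congr rfl fun m hm => ?_
  have hdeg : ∑ i, m i = j := by
    have := hq (MvPolynomial.mem_support_iff.1 hm)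
    rw [← Finsupp.degree_eq_sum, Finsupp.degree_eq_weight_one]
    exact this
  simp only [mul_pow, Finset.prod_mul_distrib, Finset.prod_pow_eq_pow_sum, hdeg]
  rw [← Polynomial.C_mul_X_pow_eq_monomial]
  simp only [map_mul, map_prod, map_pow]
  ring

lemma natDegree_lineRestriction {n : ℕ} {R : Type*} [CommRing R] (a : Fin n → R)
    (p : MvPolynomial (Fin n) R)
    (ha : MvPolynomial.eval a (MvPolynomial.homogeneousComponent p.totalDegree p) ≠ 0) :
    (lineRestriction a p).natDegree = p.totalDegree := by
  have hcoeff : ∀ j ∈ Finset.range (p.totalDegree + 1),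
      lineRestriction a (MvPolynomial.homogeneousComponent j p) =
        Polynomial.monomial j (MvPolynomial.eval a (MvPolynomial.homogeneousComponent j p)) :=
    fun j _ => lineRestriction_of_isHomogeneous a
      (MvPolynomial.homogeneousComponent_isHomogeneous j p)
  conv_lhs => rw [← MvPolynomial.sum_homogeneousComponent p, map_sum, Finset.sum_congr rfl hcoeff]
  refine le_antisymm ?_ (Polynomial.le_natDegree_of_ne_zero ?_)
  · refine Polynomial.natDegree_sum_le_of_forall_le _ _ fun j hj => ?_
    exact (Polynomial.natDegree_monomial_le _).trans
      (Nat.lt_succ_iff.1 (Finset.mem_range.1 hj))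
  · simpa [Polynomial.finsetSum_coeff, Polynomial.coeff_monomial] using ha

lemma natDegree_lineRestriction_det_pencil {n k : ℕ} (M : Fin n → Matrix (Fin k) (Fin k) ℂ)
    (a : Fin n → ℂ) (ha : (∑ i, a i • M i).det ≠ 0) :
    (lineRestriction a (pencil M).det).natDegree = k := by
  have hmap : (lineRestriction a).mapMatrix (pencil M) =
      (Polynomial.X : Polynomial ℂ) • (∑ i, a i • M i).map Polynomial.C +
        (1 : Matrix (Fin k) (Fin k) ℂ).map Polynomial.C := by
    have hCX : ∀ (z : ℂ) i, lineRestriction a (MvPolynomial.C z * MvPolynomial.X i) =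
        Polynomial.X * Polynomial.C (a i * z) := fun z i => by
      rw [map_mul, lineRestriction, MvPolynomial.coe_eval₂Hom, MvPolynomial.eval₂_C,
        MvPolynomial.eval₂_X, Polynomial.C_mul]
      ring
    rw [pencil, map_add, map_one, map_sum, add_comm,
      Matrix.map_one Polynomial.C Polynomial.C_0 Polynomial.C_1]
    congr 1
    ext1 s t
    simp only [Matrix.sum_apply, RingHom.mapMatrix_apply, Matrix.map_apply, Matrix.smul_apply,
      smul_eq_mul, hCX]
    rw [map_sum, Finset.mul_sum]
  rw [RingHom.map_det, hmap]
  refine le_antisymm ?_ (Polynomial.le_natDegree_of_ne_zero ?_)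
  · simpa using Polynomial.natDegree_det_X_add_C_le (∑ i, a i • M i) 1
  · have := Polynomial.coeff_det_X_add_C_card (∑ i, a i • M i) 1
    rw [Fintype.card_fin] at this
    rwa [this]

/-- If `∑ⱼ cⱼ N^{d-j} = 0` then `1 - N` is a left factor of the scalar matrix `∑ⱼ cⱼ`. -/
lemma one_sub_mul_sum_smul_geom_sum {R A : Type*} [CommRing R] [Ring A] [Algebra R A] (N : A)
    (d : ℕ) (c : ℕ → R) (h : ∑ j ∈ Finset.range (d + 1), c j • N ^ (d - j) = 0) :
    (1 - N) * ∑ j ∈ Finset.range (d + 1), c j • ∑ i ∈ Finset.range (d - j), N ^ i =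
      (∑ j ∈ Finset.range (d + 1), c j) • (1 : A) := by
  have hterm : ∀ j, (1 - N) * c j • ∑ i ∈ Finset.range (d - j), N ^ i =
      c j • 1 - c j • N ^ (d - j) := fun j => by
    rw [mul_smul_comm, mul_neg_geom_sum, smul_sub]
  rw [Finset.mul_sum, Finset.sum_congr rfl fun j _ => hterm j, Finset.sum_sub_distrib, h,
    sub_zero, Finset.sum_smul]

/-- If `∑ⱼ cⱼ N^{d-j} = 0` and `c_d ≠ 0` then `N` is invertible. -/
lemma det_ne_zero_of_sum_smul_pow_eq_zero {K ι : Type*} [Field K] [Fintype ι] [DecidableEq ι]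
    (N : Matrix ι ι K) (d : ℕ) (c : ℕ → K) (hc : c d ≠ 0)
    (h : ∑ j ∈ Finset.range (d + 1), c j • N ^ (d - j) = 0) : N.det ≠ 0 := by
  rw [Finset.sum_range_succ, Nat.sub_self, pow_zero] at h
  have hfac : N * ∑ j ∈ Finset.range d, c j • N ^ (d - j - 1) = -(c d • 1) := by
    rw [← eq_neg_of_add_eq_zero_left h, Finset.mul_sum]
    refine Finset.sum_congr rfl fun j hj => ?_
    rw [mul_smul_comm, mul_pow_sub_one (Nat.sub_ne_zero_of_lt (Finset.mem_range.1 hj))]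
  intro h0
  have hdet := congrArg Matrix.det hfac
  rw [Matrix.det_mul, h0, zero_mul, ← neg_smul, Matrix.det_smul, Matrix.det_one, mul_one] at hdet
  exact pow_ne_zero _ (neg_ne_zero.2 hc) hdet.symm

lemma mapMatrix_conj_pencil {n k : ℕ} (M : Fin n → Matrix (Fin k) (Fin k) ℂ)
    (hM : ∀ i, (M i).IsHermitian) :
    (MvPolynomial.map (starRingEnd ℂ)).mapMatrix (pencil M) = (pencil M)ᵀ := by
  ext1 s t
  have h : ∀ i, starRingEnd ℂ (M i s t) = M i t s := fun i => (hM i).apply t s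
  simp only [pencil, map_add, map_one, map_sum, Matrix.add_apply, Matrix.sum_apply,
    RingHom.mapMatrix_apply, Matrix.map_apply, map_mul, MvPolynomial.map_C, MvPolynomial.map_X,
    Matrix.transpose_apply, Matrix.one_apply, h, eq_comm (a := s)]

lemma eval_pencil {n k : ℕ} (M : Fin n → Matrix (Fin k) (Fin k) ℂ) (a : Fin n → ℂ) :
    (MvPolynomial.eval a).mapMatrix (pencil M) = 1 + ∑ i, a i • M i := by
  ext1 s t
  simp only [pencil, map_add, map_one, map_sum, Matrix.add_apply, Matrix.sum_apply,
    RingHom.mapMatrix_apply, Matrix.map_apply, map_mul, MvPolynomial.eval_C, MvPolynomial.eval_X,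
    Matrix.smul_apply, smul_eq_mul, mul_comm]

lemma eval_ofReal_map {n : ℕ} (a : Fin n → ℝ) (q : MvPolynomial (Fin n) ℝ) :
    MvPolynomial.eval (fun i => (a i : ℂ)) (MvPolynomial.map (algebraMap ℝ ℂ) q) =
      ((MvPolynomial.eval a q : ℝ) : ℂ) :=
  MvPolynomial.map_eval (algebraMap ℝ ℂ) a q |>.symm

/-- If `p` is an irreducible real zero polynomial of degree `d ≥ 1` with homogeneous parts
`qⱼ`, and `M₁,…,Mₙ` are hermitian `k×k` matrices such that for all `a ∈ ℝⁿ`, with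
`A = a₁M₁ + ⋯ + aₙMₙ`, `∑ⱼ qⱼ(a)·(−A)^{d−j} = 0`, then `d ∣ k` and
`det(I + x₁M₁ + ⋯ + xₙMₙ) = p^{k/d}`. -/
theorem det_pencil_of_homogenization_rep {n k : ℕ} (p : MvPolynomial (Fin n) ℝ)
    (hrz : IsRZ p) (hirr : Irreducible p)
    (d : ℕ) (hd1 : 1 ≤ d) (hd : p.totalDegree = d)
    (M : Fin n → Matrix (Fin k) (Fin k) ℂ) (hM : ∀ i, (M i).IsHermitian)
    (hann : ∀ a : Fin n → ℝ,
      ∑ j ∈ Finset.range (d + 1),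
        ((MvPolynomial.eval a (MvPolynomial.homogeneousComponent j p) : ℝ) : ℂ) •
          (-(∑ i, (a i : ℂ) • M i)) ^ (d - j) = 0) :
    d ∣ k ∧ MvPolynomial.map (algebraMap ℝ ℂ) (p ^ (k / d)) = (pencil M).det := by
  obtain ⟨hp0, -⟩ := hrz
  have hmap_inj : Function.Injective
      (MvPolynomial.map (σ := Fin n) (algebraMap ℝ ℂ)) :=
    MvPolynomial.map_injective _ (algebraMap ℝ ℂ).injective
  set N : Matrix (Fin k) (Fin k) (MvPolynomial (Fin n) ℂ) := 1 - pencil M with hN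
  set c : ℕ → MvPolynomial (Fin n) ℂ := fun j =>
    MvPolynomial.map (algebraMap ℝ ℂ) (MvPolynomial.homogeneousComponent j p) with hc
  have hsum : ∑ j ∈ Finset.range (d + 1), c j = MvPolynomial.map (algebraMap ℝ ℂ) p := by
    conv_rhs => rw [← MvPolynomial.sum_homogeneousComponent p, map_sum, hd]
  have hNzero : ∑ j ∈ Finset.range (d + 1), c j • N ^ (d - j) = 0 := by
    ext1 s t
    refine eq_of_eval_ofReal_eq fun a => ?_
    have hNa : (MvPolynomial.eval fun i => (a i : ℂ)).mapMatrix N =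
        -(∑ i, (a i : ℂ) • M i) := by
      rw [hN, map_sub, map_one, eval_pencil, sub_add_cancel_left]
    have h := congrFun (congrFun (hann a) s) t
    simp only [← hNa, ← map_pow (RingHom.mapMatrix _)] at h
    simp only [Matrix.sum_apply, Matrix.smul_apply, RingHom.mapMatrix_apply, Matrix.map_apply,
      smul_eq_mul, Matrix.zero_apply] at h
    simpa only [Matrix.sum_apply, Matrix.smul_apply, smul_eq_mul, map_sum, map_mul, hc,
      eval_ofReal_map, Matrix.zero_apply, map_zero] using h
  have hNconj : (MvPolynomial.map (starRingEnd ℂ)).mapMatrix N = Nᵀ := by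
    rw [hN, map_sub, map_one, mapMatrix_conj_pencil M hM, Matrix.transpose_sub,
      Matrix.transpose_one]
  have hfac := one_sub_mul_sum_smul_geom_sum N d c hNzero
  set Q := ∑ j ∈ Finset.range (d + 1), c j • ∑ i ∈ Finset.range (d - j), N ^ i with hQ
  have hQconj : (MvPolynomial.map (starRingEnd ℂ)).mapMatrix Q = Qᵀ := by
    have hcconj : ∀ j, MvPolynomial.map (starRingEnd ℂ) (c j) = c j := fun j => by
      rw [hc, MvPolynomial.map_map]
      congr 2
      ext x
      simp
    have hsmul : ∀ j (B : Matrix (Fin k) (Fin k) (MvPolynomial (Fin n) ℂ)),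
        (MvPolynomial.map (starRingEnd ℂ)).mapMatrix (c j • B) =
          c j • (MvPolynomial.map (starRingEnd ℂ)).mapMatrix B := fun j B => by
      ext1 s t
      simp [hcconj]
    simp only [hQ, map_sum, hsmul, map_pow, hNconj, Matrix.transpose_sum, Matrix.transpose_smul,
      Matrix.transpose_pow]
  obtain ⟨g, hg⟩ := exists_map_ofReal_eq_det (mapMatrix_conj_pencil M hM)
  obtain ⟨h, hh⟩ := exists_map_ofReal_eq_det hQconj
  have hdvd : g ∣ p ^ k := by
    refine ⟨h, hmap_inj ?_⟩
    rw [hsum, hN, sub_sub_cancel] at hfac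
    have := congrArg Matrix.det hfac
    rw [Matrix.det_mul, Matrix.det_smul, Matrix.det_one, mul_one, Fintype.card_fin] at this
    rw [map_mul, map_pow, hg, hh, this]
  obtain ⟨r, -, u, hu⟩ := (dvd_prime_pow hirr.prime k).1 hdvd
  have hg0 : MvPolynomial.eval (0 : Fin n → ℝ) g = 1 := by
    apply Complex.ofReal_injective
    rw [← eval_ofReal_map, hg, RingHom.map_det, eval_pencil]
    simp
  have hgp : g = p ^ r := by
    obtain ⟨x, -, hx⟩ := MvPolynomial.isUnit_iff_eq_C_of_isReduced.1 u.isUnit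
    have h0 := congrArg (MvPolynomial.eval (0 : Fin n → ℝ)) hu
    rw [hx, map_mul, hg0, map_pow, hp0, one_pow, one_mul, MvPolynomial.eval_C] at h0
    rw [← hu, hx, h0, map_one, mul_one]
  have hk : k = r * d := by
    obtain ⟨a, ha⟩ : ∃ a : Fin n → ℝ,
        MvPolynomial.eval a (MvPolynomial.homogeneousComponent d p) ≠ 0 := by
      by_contra! hcon
      exact homogeneousComponent_totalDegree_ne_zero hirr.ne_zero
        (hd ▸ MvPolynomial.funext fun a => by rw [hcon a, map_zero])
    have hdet : (∑ i, (a i : ℂ) • M i).det ≠ 0 := by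
      have hneg := det_ne_zero_of_sum_smul_pow_eq_zero _ d
        (fun j => ((MvPolynomial.eval a (MvPolynomial.homogeneousComponent j p) : ℝ) : ℂ))
        (Complex.ofReal_ne_zero.2 ha) (hann a)
      rw [Matrix.det_neg] at hneg
      exact right_ne_zero_of_mul hneg
    have hdeg := natDegree_lineRestriction_det_pencil M (fun i => (a i : ℂ)) hdet
    have hline : lineRestriction (fun i => (a i : ℂ)) (MvPolynomial.map (algebraMap ℝ ℂ) p) =
        (lineRestriction a p).map (algebraMap ℝ ℂ) := by
      simp only [lineRestriction, MvPolynomial.coe_eval₂Hom, MvPolynomial.eval₂_map,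
        ← Polynomial.coe_mapRingHom, MvPolynomial.hom_eval₂]
      congr 1
      · ext x
        simp
      · funext i
        simp
    rw [← hg, hgp, map_pow, map_pow, Polynomial.natDegree_pow, hline, Polynomial.natDegree_map,
      natDegree_lineRestriction a p (hd.symm ▸ ha), hd] at hdeg
    exact hdeg.symm
  refine ⟨⟨r, by rw [hk, mul_comm]⟩, ?_⟩
  rw [← hg, hgp, show k / d = r by rw [hk, Nat.mul_div_cancel _ hd1]]
end

section
/- Let p(x) = xᵀAx + bᵀx + 1 ∈ ℝ[x₁,…,xₙ] be a quadratic real zero polynomial, where A is a real symmetric n×n matrix and b ∈ ℝⁿ; then ¼bbᵀ − A is positive semidefinite, and let C denote its positive semidefinite symmetric square root. Let Cl_n(ℂ) be the Clifford algebra over ℂ of the quadratic form Q(z) = z₁² + ⋯ + zₙ² on ℂⁿ, with generators σᵢ = ι(eᵢ) (so σᵢ² = 1 and σᵢσⱼ = −σⱼσᵢ for i ≠ j). For a ∈ ℝⁿ define c_a = Σᵢ (Ca)ᵢ·σᵢ + ½(bᵀa)·1 ∈ Cl_n(ℂ). Then for every a ∈ ℝⁿ, c_a² = (bᵀa)·c_a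 − (aᵀAa)·1. -/
open Matrix

/-- The standard quadratic form `Q(z) = z₁² + ⋯ + zₙ²` on `ℂⁿ`. -/
noncomputable def stdQF (n : ℕ) : QuadraticForm ℂ (Fin n → ℂ) :=
  QuadraticMap.weightedSumSquares ℂ (fun _ : Fin n => (1 : ℂ))

/-- The standard generators `σᵢ = ι(eᵢ)` of the Clifford algebra `Cl_n(ℂ)`. -/
noncomputable def cliffGen {n : ℕ} (i : Fin n) : CliffordAlgebra (stdQF n) :=
  CliffordAlgebra.ι (stdQF n) (Pi.single i (1 : ℂ))

/-- A real quadratic `α t² + β t + 1` all of whose complex roots are real has nonnegative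
discriminant. -/
lemma le_sq_div_four_of_roots_real (α β : ℝ)
    (h : ∀ μ : ℂ, (α : ℂ) * μ ^ 2 + (β : ℂ) * μ + 1 = 0 → μ.im = 0) : α ≤ β ^ 2 / 4 := by
  by_contra! hlt
  have hα : 0 < α := lt_of_le_of_lt (by positivity) hlt
  set s := √(4 * α - β ^ 2)
  have hs : 0 < s := Real.sqrt_pos.2 (by linarith)
  have hs2 : s ^ 2 = 4 * α - β ^ 2 := Real.sq_sqrt (by linarith)
  have him := h ⟨-β / (2 * α), s / (2 * α)⟩ (by
    apply Complex.ext
    · simp [pow_two]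
      field_simp
      linarith
    · simp [pow_two]
      field_simp
      ring)
  exact (div_pos hs (by positivity)).ne' him

/-- The quadratic form of `¼bbᵀ − A`. -/
lemma dotProduct_quarter_vecMulVec_sub_mulVec {ι : Type*} [Fintype ι] (A : Matrix ι ι ℝ)
    (a b : ι → ℝ) :
    a ⬝ᵥ ((1 / 4 : ℝ) • Matrix.vecMulVec b b - A) *ᵥ a =
      (b ⬝ᵥ a) ^ 2 / 4 - a ⬝ᵥ A *ᵥ a := by
  rw [Matrix.sub_mulVec, Matrix.smul_mulVec, Matrix.vecMulVec_mulVec, dotProduct_sub,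
    dotProduct_smul]
  simp [dotProduct_comm a b]
  ring

lemma sum_smul_cliffGen {n : ℕ} (v : Fin n → ℂ) :
    ∑ i, v i • cliffGen i = CliffordAlgebra.ι (stdQF n) v := by
  conv_rhs => rw [pi_eq_sum_univ' v]
  simp [cliffGen, map_sum]

lemma stdQF_ofReal {n : ℕ} (v : Fin n → ℝ) :
    stdQF n (fun i => (v i : ℂ)) = ((v ⬝ᵥ v : ℝ) : ℂ) := by
  simp [stdQF, QuadraticMap.weightedSumSquares_apply, dotProduct]

/-- For a quadratic real zero polynomial `p(x) = xᵀAx + bᵀx + 1`, the matrix `¼bbᵀ − A` is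
positive semidefinite, and if `C` is its positive semidefinite square root, then the elements
`c_a = ∑ᵢ (Ca)ᵢ σᵢ + ½(bᵀa)·1` of `Cl_n(ℂ)` satisfy `c_a² = (bᵀa)·c_a − (aᵀAa)·1`. -/
theorem clifford_relation_of_quadratic_RZ {n : ℕ}
    (A : Matrix (Fin n) (Fin n) ℝ) (hA : A.IsSymm) (b : Fin n → ℝ)
    (hrz : ∀ (a : Fin n → ℝ) (μ : ℂ),
      ((a ⬝ᵥ A.mulVec a : ℝ) : ℂ) * μ ^ 2 + ((b ⬝ᵥ a : ℝ) : ℂ) * μ + 1 = 0 → μ.im = 0) :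
    ((1 / 4 : ℝ) • Matrix.vecMulVec b b - A).PosSemidef ∧
    ∀ C : Matrix (Fin n) (Fin n) ℝ, C.PosSemidef →
      C * C = (1 / 4 : ℝ) • Matrix.vecMulVec b b - A →
      ∀ a : Fin n → ℝ,
        ((∑ i, ((C.mulVec a i : ℝ) : ℂ) • cliffGen i) +
            (((1 / 2 : ℝ) * (b ⬝ᵥ a) : ℝ) : ℂ) • (1 : CliffordAlgebra (stdQF n))) *
          ((∑ i, ((C.mulVec a i : ℝ) : ℂ) • cliffGen i) +
            (((1 / 2 : ℝ) * (b ⬝ᵥ a) : ℝ) : ℂ) • (1 : CliffordAlgebra (stdQF n))) =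
        ((b ⬝ᵥ a : ℝ) : ℂ) •
            ((∑ i, ((C.mulVec a i : ℝ) : ℂ) • cliffGen i) +
              (((1 / 2 : ℝ) * (b ⬝ᵥ a) : ℝ) : ℂ) • (1 : CliffordAlgebra (stdQF n))) -
          ((a ⬝ᵥ A.mulVec a : ℝ) : ℂ) • (1 : CliffordAlgebra (stdQF n)) := by
  refine ⟨.of_dotProduct_mulVec_nonneg ?_ fun a => ?_, fun C hC hCC a => ?_⟩
  · ext i j
    simp [Matrix.vecMulVec_apply, hA.apply, mul_comm (b i)]
  · rw [star_trivial, dotProduct_quarter_vecMulVec_sub_mulVec]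
    exact sub_nonneg.2 (le_sq_div_four_of_roots_real _ _ (hrz a))
  · have hnorm : C *ᵥ a ⬝ᵥ C *ᵥ a = (b ⬝ᵥ a) ^ 2 / 4 - a ⬝ᵥ A *ᵥ a := by
      have hCt : Cᵀ = C := by simpa [Matrix.IsHermitian] using hC.isHermitian
      rw [← dotProduct_quarter_vecMulVec_sub_mulVec, ← hCC, ← Matrix.mulVec_mulVec,
        Matrix.dotProduct_mulVec a C, ← Matrix.mulVec_transpose, hCt]
    have hsq := CliffordAlgebra.ι_sq_scalar (stdQF n) (fun i => ((C *ᵥ a) i : ℂ))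
    rw [stdQF_ofReal, hnorm, Algebra.algebraMap_eq_smul_one] at hsq
    rw [sum_smul_cliffGen (fun i => ((C *ᵥ a) i : ℂ))]
    simp only [add_mul, mul_add, hsq, smul_mul_assoc, mul_smul_comm, one_mul, mul_one]
    push_cast
    module
end

section
/- Let p ∈ ℝ[x₁,…,xₙ] be a quadratic real zero polynomial. Then its rigidly convex set S(p) is a spectrahedron: there exist k ∈ ℕ and complex hermitian k×k matrices M₁,…,Mₙ such that S(p) = {a ∈ ℝⁿ : I + a₁M₁ + ⋯ + aₙMₙ is positive semidefinite}. -/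
open MvPolynomial Matrix
open scoped ComplexOrder

/-- Every monomial exponent of degree at most two is zero, a single variable, or a product of
two variables. -/
theorem Finsupp.eq_zero_or_single_or_add_single_of_degree_le_two {σ : Type*} {s : σ →₀ ℕ}
    (hs : s.degree ≤ 2) :
    s = 0 ∨ (∃ i, s = Finsupp.single i 1) ∨
      ∃ i j, s = Finsupp.single i 1 + Finsupp.single j 1 := by
  classical
  have peel : ∀ t : σ →₀ ℕ, t ≠ 0 →
      ∃ i u, t = Finsupp.single i 1 + u ∧ t.degree = 1 + u.degree := by
    intro t ht
    obtain ⟨i, hi⟩ := Finsupp.ne_iff.mp ht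
    have h : Finsupp.single i 1 ≤ t := by
      rw [Finsupp.single_le_iff]
      exact Nat.one_le_iff_ne_zero.mpr hi
    obtain ⟨u, rfl⟩ := exists_add_of_le h
    exact ⟨i, u, rfl, by simp⟩
  by_cases h0 : s = 0
  · exact Or.inl h0
  obtain ⟨i, u, rfl, hu⟩ := peel s h0
  by_cases h1 : u = 0
  · exact Or.inr (Or.inl ⟨i, by simp [h1]⟩)
  obtain ⟨j, w, rfl, hw⟩ := peel u h1
  have hw0 : w = 0 := by
    rw [← Finsupp.degree_eq_zero_iff]
    omega
  exact Or.inr (Or.inr ⟨i, j, by simp [hw0]⟩)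

/-- A polynomial of total degree at most two is the sum of a constant, a linear form and a
quadratic form. -/
theorem MvPolynomial.exists_eq_quadratic_of_totalDegree_le_two {n : ℕ}
    {R : Type*} [CommSemiring R] (p : MvPolynomial (Fin n) R) (hp : p.totalDegree ≤ 2) :
    ∃ (c : R) (b : Fin n → R) (A : Matrix (Fin n) (Fin n) R),
      p = C c + ∑ i, C (b i) * X i + ∑ i, ∑ j, C (A i j) * X i * X j := by
  rw [p.as_sum]
  refine Finset.sum_induction _ (fun q => ∃ (c : R) (b : Fin n → R)
    (A : Matrix (Fin n) (Fin n) R),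
      q = C c + ∑ i, C (b i) * X i + ∑ i, ∑ j, C (A i j) * X i * X j) ?_ ?_ ?_
  · rintro _ _ ⟨c, b, A, rfl⟩ ⟨c', b', A', rfl⟩
    refine ⟨c + c', b + b', A + A', ?_⟩
    simp only [Pi.add_apply, Matrix.add_apply, C_add, add_mul, Finset.sum_add_distrib]
    ring
  · exact ⟨0, 0, 0, by simp⟩
  · intro s hs
    have hdeg : s.degree ≤ 2 := (le_totalDegree hs).trans hp
    obtain rfl | ⟨i, rfl⟩ | ⟨i, j, rfl⟩ :=
      Finsupp.eq_zero_or_single_or_add_single_of_degree_le_two hdeg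
    · exact ⟨coeff 0 p, 0, 0, by simp⟩
    · refine ⟨0, Pi.single i (coeff (Finsupp.single i 1) p), 0, ?_⟩
      rw [Finset.sum_eq_single i (fun k _ hk => by simp [hk]) (by simp)]
      simp [C_mul_X_eq_monomial]
    · refine ⟨0, 0, Matrix.single i j (coeff (Finsupp.single i 1 + Finsupp.single j 1) p), ?_⟩
      simp only [Pi.zero_apply, C_0, zero_mul, Finset.sum_const_zero, zero_add]
      rw [Finset.sum_eq_single i
          (fun k _ hk => Finset.sum_eq_zero fun l _ => by
            simp [hk.symm]) (by simp),
        Finset.sum_eq_single j (fun l _ hl => by simp [hl.symm]) (by simp),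
        Matrix.single_apply_same, C_mul_X_eq_monomial, X, monomial_mul, mul_one]

open scoped MatrixOrder in
theorem Matrix.PosSemidef.exists_eq_conjTranspose_mul_self {ι 𝕜 : Type*} [RCLike 𝕜]
    [Fintype ι] {G : Matrix ι ι 𝕜} (hG : G.PosSemidef) : ∃ B : Matrix ι ι 𝕜, G = Bᴴ * B := by
  classical
  exact CStarAlgebra.nonneg_iff_eq_star_mul_self.mp hG.nonneg

/-- The arrow matrix with constant diagonal `c` and border `v`. -/
noncomputable def arrowMatrix {ι : Type*} [DecidableEq ι] (c : ℝ) (v : ι → ℝ) :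
    Matrix (Unit ⊕ ι) (Unit ⊕ ι) ℂ :=
  fromBlocks (diagonal fun _ => (c : ℂ)) (of fun _ j => (v j : ℂ))
    (of fun _ j => (v j : ℂ))ᴴ (diagonal fun _ => (c : ℂ))

theorem isHermitian_arrowMatrix {ι : Type*} [DecidableEq ι] (c : ℝ) (v : ι → ℝ) :
    (arrowMatrix c v).IsHermitian := by
  refine IsHermitian.fromBlocks ?_ rfl ?_ <;>
  · refine isHermitian_diagonal_of_self_adjoint _ (funext fun _ => ?_)
    simp

theorem posSemidef_arrowMatrix_iff_of_pos {ι : Type*} [Fintype ι] [DecidableEq ι] {c : ℝ}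
    (hc : 0 < c) (v : ι → ℝ) : (arrowMatrix c v).PosSemidef ↔ ∑ i, v i ^ 2 ≤ c ^ 2 := by
  have hD : (diagonal fun _ : ι => (c : ℂ)).PosDef := PosDef.diagonal fun _ => by
    exact_mod_cast hc
  have : Invertible (diagonal fun _ : ι => (c : ℂ)) := hD.isUnit.invertible
  rw [arrowMatrix, PosDef.fromBlocks₂₂ _ _ hD]
  have hinv : (diagonal fun _ : ι => (c : ℂ))⁻¹ = diagonal fun _ : ι => (c : ℂ)⁻¹ := by
    refine Matrix.inv_eq_right_inv ?_
    have : (c : ℂ) ≠ 0 := by exact_mod_cast hc.ne'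
    simp [diagonal_mul_diagonal, this]
  have hS : (diagonal fun _ : Unit => (c : ℂ)) - (of fun _ j => (v j : ℂ)) *
      (diagonal fun _ : ι => (c : ℂ))⁻¹ * (of fun _ j => (v j : ℂ))ᴴ =
      diagonal fun _ => ((c - c⁻¹ * ∑ i, v i ^ 2 : ℝ) : ℂ) := by
    ext i j
    rw [hinv, Matrix.sub_apply, Matrix.mul_apply]
    simp [mul_diagonal, Finset.mul_sum]
    exact Finset.sum_congr rfl fun k _ => by ring
  rw [hS, posSemidef_diagonal_iff]
  simp only [forall_const, Complex.zero_le_real, sub_nonneg, inv_mul_le_iff₀ hc, sq c]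

theorem posSemidef_arrowMatrix_iff {ι : Type*} [Fintype ι] [DecidableEq ι] (c : ℝ)
    (v : ι → ℝ) : (arrowMatrix c v).PosSemidef ↔ √(∑ i, v i ^ 2) ≤ c := by
  constructor
  · intro h
    have hc : 0 ≤ c := by
      simpa [arrowMatrix] using h.diag_nonneg (i := Sum.inl ())
    refine le_of_forall_pos_le_add fun ε hε => ?_
    have hsum : arrowMatrix (c + ε) v = arrowMatrix c v + (ε : ℂ) • 1 := by
      ext (i | i) (j | j)
      · simp [arrowMatrix]
      · simp [arrowMatrix]
      · simp [arrowMatrix]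
      · by_cases hij : i = j <;> simp [arrowMatrix, hij]
    have hpsd : (arrowMatrix (c + ε) v).PosSemidef := by
      rw [hsum]
      exact h.add (PosSemidef.one.smul (by exact_mod_cast hε.le))
    exact Real.sqrt_le_iff.mpr
      ⟨by positivity, (posSemidef_arrowMatrix_iff_of_pos (by positivity) v).mp hpsd⟩
  · intro h
    have hc : 0 ≤ c := (Real.sqrt_nonneg _).trans h
    obtain hc | rfl := hc.lt_or_eq
    · exact (posSemidef_arrowMatrix_iff_of_pos hc v).mpr (Real.sqrt_le_iff.mp h).2
    · have h0 : ∑ i, v i ^ 2 ≤ 0 := Real.sqrt_eq_zero'.mp (h.antisymm (Real.sqrt_nonneg _))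
      have hv : ∀ i, v i = 0 := fun i => by
        have := (Finset.single_le_sum (fun j _ => sq_nonneg (v j)) (Finset.mem_univ i)).trans h0
        exact pow_eq_zero_iff two_ne_zero |>.mp (this.antisymm (sq_nonneg _))
      have : arrowMatrix 0 v = 0 := by
        ext (i | i) (j | j) <;> simp [arrowMatrix, hv]
      rw [this]
      exact PosSemidef.zero

/-- `1 + 2mt + (m² - s²)t²` factors as `(1 + (m - s)t)(1 + (m + s)t)`, so its absence of zeros on
`[0,1)` is decided by the smaller slope. -/
theorem forall_Ico_quadratic_ne_zero_iff (m s : ℝ) (hs : 0 ≤ s) :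
    (∀ t ∈ Set.Ico (0 : ℝ) 1, (1 + t * m) ^ 2 - (t * s) ^ 2 ≠ 0) ↔ s ≤ 1 + m := by
  constructor
  · intro h
    by_contra! hlt
    have hpos : 0 < s - m := by linarith
    refine h (s - m)⁻¹ ⟨by positivity, inv_lt_one_of_one_lt₀ (by linarith)⟩ ?_
    field_simp
    ring
  · rintro h t ⟨ht0, ht1⟩
    have h1 : 0 < 1 + t * (m - s) := by nlinarith
    have h2 : 0 < 1 + t * (m + s) := by nlinarith
    have := mul_pos h1 h2
    nlinarith

/-- A real quadratic with constant term `1` all of whose complex roots are real has nonnegative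
discriminant. -/
theorem four_mul_le_sq_of_forall_root_im_eq_zero {l q : ℝ}
    (h : ∀ μ : ℂ, 1 + μ * l + μ ^ 2 * q = 0 → μ.im = 0) : 4 * q ≤ l ^ 2 := by
  by_contra! hlt
  have hq : 0 < q := by nlinarith [sq_nonneg l]
  obtain ⟨r, hrpos, hr⟩ : ∃ r : ℝ, 0 < r ∧ r ^ 2 = 4 * q - l ^ 2 :=
    ⟨√(4 * q - l ^ 2), Real.sqrt_pos.mpr (by linarith), Real.sq_sqrt (by linarith)⟩
  have := h ⟨-l / (2 * q), r / (2 * q)⟩ (by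
    apply Complex.ext
    · simp [sq]
      field_simp
      linear_combination -hr
    · simp [sq]
      field_simp
      ring)
  exact absurd this (by positivity)

/-- The rigidly convex set of a quadratic real zero polynomial is a spectrahedron: there are
hermitian matrices `M₁,…,Mₙ` such that `a ∈ S(p)` iff `I + a₁M₁ + ⋯ + aₙMₙ ⪰ 0`. -/
theorem quadratic_rigidlyConvex_is_spectrahedron {n : ℕ}
    (p : MvPolynomial (Fin n) ℝ) (hrz : IsRZ p) (hdeg : p.totalDegree = 2) :
    ∃ (k : ℕ) (M : Fin n → Matrix (Fin k) (Fin k) ℂ), (∀ i, (M i).IsHermitian) ∧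
      ∀ a : Fin n → ℝ,
        ((1 + ∑ i, (a i : ℂ) • M i).PosSemidef ↔
          ∀ t ∈ Set.Ico (0 : ℝ) 1, MvPolynomial.eval (t • a) p ≠ 0) := by
  obtain ⟨c, b, A, rfl⟩ := p.exists_eq_quadratic_of_totalDegree_le_two hdeg.le
  obtain ⟨h0, hroot⟩ := hrz
  obtain rfl : c = 1 := by simpa using h0
  have heval : ∀ (t : ℝ) (a : Fin n → ℝ),
      eval (t • a) (C 1 + ∑ i, C (b i) * X i + ∑ i, ∑ j, C (A i j) * X i * X j) =
        1 + t * (b ⬝ᵥ a) + t ^ 2 * (a ⬝ᵥ A *ᵥ a) := by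
    intro t a
    simp only [map_add, map_sum, map_mul, eval_C, eval_X, Pi.smul_apply, smul_eq_mul, dotProduct,
      mulVec, Finset.mul_sum]
    congr 2
    · exact Finset.sum_congr rfl fun i _ => by ring
    · exact funext fun i => Finset.sum_congr rfl fun j _ => by ring
  have hdisc : ∀ a : Fin n → ℝ, 4 * (a ⬝ᵥ A *ᵥ a) ≤ (b ⬝ᵥ a) ^ 2 := by
    intro a
    refine four_mul_le_sq_of_forall_root_im_eq_zero fun μ hμ => hroot a μ ?_
    rw [← hμ]
    simp only [map_add, map_sum, map_mul, map_C, map_X, eval_C, eval_X, dotProduct,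
      mulVec, Finset.mul_sum, Complex.ofReal_sum, Complex.ofReal_mul, map_one]
    congr 2
    · exact Finset.sum_congr rfl fun i _ => by simp; ring
    · exact funext fun i => Finset.sum_congr rfl fun j _ => by simp; ring
  set G : Matrix (Fin n) (Fin n) ℝ :=
    (1 / 4 : ℝ) • vecMulVec b b - (1 / 2 : ℝ) • (A + Aᵀ) with hG
  have hGform : ∀ a, a ⬝ᵥ G *ᵥ a = (b ⬝ᵥ a) ^ 2 / 4 - a ⬝ᵥ A *ᵥ a := by
    intro a
    have h1 : a ⬝ᵥ vecMulVec b b *ᵥ a = (b ⬝ᵥ a) ^ 2 := by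
      rw [vecMulVec_mulVec, dotProduct_comm b a, sq]
      simp
    have h2 : a ⬝ᵥ Aᵀ *ᵥ a = a ⬝ᵥ A *ᵥ a := by
      rw [mulVec_transpose, dotProduct_comm, dotProduct_mulVec]
    rw [hG, sub_mulVec, smul_mulVec, smul_mulVec, add_mulVec, dotProduct_sub, dotProduct_smul,
      dotProduct_smul, dotProduct_add, h1, h2]
    simp only [smul_eq_mul]
    ring
  have hGpsd : G.PosSemidef := by
    refine .of_dotProduct_mulVec_nonneg ?_ fun a => ?_
    · ext i j
      simp [hG, vecMulVec_apply]
      ring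
    · rw [star_trivial, hGform]
      linarith [hdisc a]
  obtain ⟨B, hB⟩ := hGpsd.exists_eq_conjTranspose_mul_self
  have hBform : ∀ a, ∑ i, (B *ᵥ a) i ^ 2 = (b ⬝ᵥ a) ^ 2 / 4 - a ⬝ᵥ A *ᵥ a := by
    intro a
    rw [← hGform, hB, ← mulVec_mulVec, dotProduct_mulVec, vecMul_conjTranspose]
    simp [dotProduct, sq]
  let e : Fin (1 + n) ≃ Unit ⊕ Fin n :=
    finSumFinEquiv.symm.trans (Equiv.sumCongr (Equiv.equivPUnit _) (Equiv.refl _))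
  refine ⟨1 + n, fun i => (arrowMatrix (b i / 2) (Bᵀ i)).submatrix e e,
    fun i => (isHermitian_arrowMatrix _ _).submatrix e, fun a => ?_⟩
  have hpencil : 1 + ∑ i, (a i : ℂ) • (arrowMatrix (b i / 2) (Bᵀ i)).submatrix e e =
      (arrowMatrix (1 + (b ⬝ᵥ a) / 2) (B *ᵥ a)).submatrix e e := by
    have : 1 + ∑ i, (a i : ℂ) • arrowMatrix (b i / 2) (Bᵀ i) =
        arrowMatrix (1 + (b ⬝ᵥ a) / 2) (B *ᵥ a) := by
      ext (i | i) (j | j)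
      · simp [arrowMatrix, Matrix.sum_apply, dotProduct, Finset.sum_div]
        exact Finset.sum_congr rfl fun k _ => by ring
      · simp [arrowMatrix, Matrix.sum_apply, mulVec, dotProduct, mul_comm]
      · simp [arrowMatrix, Matrix.sum_apply, mulVec, dotProduct, mul_comm]
      · by_cases hij : i = j
        · subst hij
          simp [arrowMatrix, Matrix.sum_apply, dotProduct, Finset.sum_div]
          exact Finset.sum_congr rfl fun k _ => by ring
        · simp [arrowMatrix, Matrix.sum_apply, hij]
    rw [← this]
    ext i j
    simp [Matrix.sum_apply, Matrix.one_apply]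
  rw [hpencil, posSemidef_submatrix_equiv, posSemidef_arrowMatrix_iff,
    ← forall_Ico_quadratic_ne_zero_iff _ _ (Real.sqrt_nonneg _)]
  refine forall₂_congr fun t _ => ?_
  have hsq := Real.sq_sqrt (Finset.sum_nonneg fun i (_ : i ∈ Finset.univ) =>
    sq_nonneg ((B *ᵥ a) i))
  rw [heval, mul_pow t, hsq, hBform, ne_eq, ne_eq]
  ring_nf
end
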